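/- Let n ≥ 2, 0 < λ ≤ Λ, q ∈ [0,n), and let v be a generalized solution of λ v^q χ_{{v>0}} ≤ det D²v ≤ Λ v^q χ_{{v>0}} in an open convex set Ω ⊆ ℝⁿ, with coincidence set K := {x ∈ Ω : v(x)=0}. Suppose x₀ ∈ Ω is an extreme point of K. Then x₀ is not an endpoint of any nondegenerate line segment contained in ∂K, and x₀ is an exposed point of K. Moreover, if in addition K has Lebesgue measure zero, then K = {x₀}. -/

import Mathlib

open MeasureTheory Set Metric
open scoped RealInnerProductSpace

noncomputable section

/-- The subdifferential of a convex function `v` at `x`, relative to the domain `Ω`. -/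
def subgrad {n : ℕ} (Ω : Set (EuclideanSpace ℝ (Fin n))) (v : EuclideanSpace ℝ (Fin n) → ℝ)
    (x : EuclideanSpace ℝ (Fin n)) : Set (EuclideanSpace ℝ (Fin n)) :=
  {p | ∀ y ∈ Ω, v x + ⟪p, y - x⟫ ≤ v y}

/-- The image `∂v(E) = ⋃_{x ∈ E} ∂v(x)` of a set under the subdifferential. -/
def subgradImg {n : ℕ} (Ω : Set (EuclideanSpace ℝ (Fin n))) (v : EuclideanSpace ℝ (Fin n) → ℝ)
    (E : Set (EuclideanSpace ℝ (Fin n))) : Set (EuclideanSpace ℝ (Fin n)) :=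
  ⋃ x ∈ E, subgrad Ω v x

/-- The last coordinate `x_n` of a point of `ℝⁿ`. -/
def lastCoord {n : ℕ} (x : EuclideanSpace ℝ (Fin n)) : ℝ :=
  if h : 0 < n then x ⟨n - 1, by omega⟩ else 0

/-- The first `n-1` coordinates `x'` of a point of `ℝⁿ`. -/
def fstCoords {n : ℕ} (x : EuclideanSpace ℝ (Fin n)) : EuclideanSpace ℝ (Fin (n - 1)) :=
  (EuclideanSpace.equiv (Fin (n - 1)) ℝ).symm
    (fun i => x ⟨i, lt_of_lt_of_le i.isLt (Nat.sub_le n 1)⟩)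

/-- The point `(x', t) ∈ ℝⁿ = ℝ^{n-1} × ℝ`. -/
def app (n : ℕ) (x' : EuclideanSpace ℝ (Fin (n - 1))) (t : ℝ) : EuclideanSpace ℝ (Fin n) :=
  (EuclideanSpace.equiv (Fin n) ℝ).symm
    (fun i => if h : (i : ℕ) < n - 1 then x' ⟨i, h⟩ else t)

/-- `v` is a generalized (Aleksandrov) solution of
`λ v^q χ_{v>0} ≤ det D²v ≤ Λ v^q χ_{v>0}` on the open convex set `Ω`:
`v` is continuous, convex and nonnegative on `Ω`, and for every Borel `E ⊆ Ω` one has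
`|∂v(E)| ≤ Λ ∫_{E ∩ {v>0}} v^q` and `|∂v(E ∩ {v>0})| ≥ λ ∫_{E ∩ {v>0}} v^q`. -/
def GenSol (n : ℕ) (q lam Lam : ℝ) (Ω : Set (EuclideanSpace ℝ (Fin n)))
    (v : EuclideanSpace ℝ (Fin n) → ℝ) : Prop :=
  ContinuousOn v Ω ∧ ConvexOn ℝ Ω v ∧ (∀ x ∈ Ω, 0 ≤ v x) ∧
  (∀ E : Set (EuclideanSpace ℝ (Fin n)), MeasurableSet E → E ⊆ Ω →
    volume (subgradImg Ω v E) ≤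
      ENNReal.ofReal Lam * ∫⁻ x in E ∩ {x | 0 < v x}, ENNReal.ofReal (v x ^ q)) ∧
  (∀ E : Set (EuclideanSpace ℝ (Fin n)), MeasurableSet E → E ⊆ Ω →
    ENNReal.ofReal lam * ∫⁻ x in E ∩ {x | 0 < v x}, ENNReal.ofReal (v x ^ q) ≤
      volume (subgradImg Ω v (E ∩ {x | 0 < v x})))

/-- The coincidence set `K = {x ∈ Ω : v x = 0}`. -/
def coin {n : ℕ} (Ω : Set (EuclideanSpace ℝ (Fin n))) (v : EuclideanSpace ℝ (Fin n) → ℝ) :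
    Set (EuclideanSpace ℝ (Fin n)) :=
  {x ∈ Ω | v x = 0}

/-- Euclidean space of dimension `n`. -/
abbrev Euc (n : ℕ) := EuclideanSpace ℝ (Fin n)

/-- The `i`-th standard unit vector. -/
abbrev unitVec {n : ℕ} (i : Fin n) : Euc n := EuclideanSpace.single i 1

theorem volume_cube_lt {n : ℕ} (ρ : ℝ) :
    volume {a : Euc n | ∀ i, |a i| < ρ} = ENNReal.ofReal (2 * ρ) ^ n := by
  have h : {a : Euc n | ∀ i, |a i| < ρ} =
      (WithLp.ofLp : Euc n → Fin n → ℝ) ⁻¹' (Set.univ.pi fun _ => Ioo (-ρ) ρ) := by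
    ext a; simp [abs_lt]
  rw [h, (PiLp.volume_preserving_ofLp (Fin n)).measure_preimage
    (MeasurableSet.univ_pi fun _ => measurableSet_Ioo).nullMeasurableSet, Real.volume_pi_Ioo]
  simp [two_mul]

theorem volume_cube_le {n : ℕ} (ρ : ℝ) :
    volume {a : Euc n | ∀ i, |a i| ≤ ρ} = ENNReal.ofReal (2 * ρ) ^ n := by
  have h : {a : Euc n | ∀ i, |a i| ≤ ρ} =
      (WithLp.ofLp : Euc n → Fin n → ℝ) ⁻¹' (Set.univ.pi fun _ => Icc (-ρ) ρ) := by
    ext a; simp [abs_le, Pi.le_def, forall_and]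
  rw [h, (PiLp.volume_preserving_ofLp (Fin n)).measure_preimage
    (MeasurableSet.univ_pi fun _ => measurableSet_Icc).nullMeasurableSet, volume_pi_pi]
  simp [two_mul]

theorem linearMap_apply_eq_sum {n : ℕ} (A : Euc n →ₗ[ℝ] Euc n) (a : Euc n) :
    A a = ∑ i, a i • A (unitVec i) := by
  conv_lhs => rw [← (EuclideanSpace.basisFun (Fin n) ℝ).sum_repr a]
  simp

theorem adjoint_apply_coord {n : ℕ} (A : Euc n →ₗ[ℝ] Euc n) (p : Euc n) (i : Fin n) :
    (LinearMap.adjoint A p) i = ⟪p, A (unitVec i)⟫ := by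
  rw [← LinearMap.adjoint_inner_left]
  simp [unitVec, EuclideanSpace.inner_single_right]

theorem det_adjoint_eq {n : ℕ} (A : Euc n →ₗ[ℝ] Euc n) :
    LinearMap.det (LinearMap.adjoint A) = LinearMap.det A := by
  rw [← LinearMap.det_toMatrix (EuclideanSpace.basisFun (Fin n) ℝ).toBasis,
    LinearMap.toMatrix_adjoint, Matrix.det_conjTranspose, LinearMap.det_toMatrix]
  simp

theorem volume_dual_cube_lt {n : ℕ} (A : Euc n →ₗ[ℝ] Euc n) (hA : LinearMap.det A ≠ 0) (r : ℝ) :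
    volume {p : Euc n | ∀ i, |⟪p, A (unitVec i)⟫| < r} =
      ENNReal.ofReal |LinearMap.det A|⁻¹ * ENNReal.ofReal (2 * r) ^ n := by
  have h : {p : Euc n | ∀ i, |⟪p, A (unitVec i)⟫| < r} =
      LinearMap.adjoint A ⁻¹' {a : Euc n | ∀ i, |a i| < r} := by
    ext p; simp only [mem_ofPred_eq, mem_preimage, adjoint_apply_coord]
  rw [h, Measure.addHaar_preimage_linearMap _ (by rwa [det_adjoint_eq]), det_adjoint_eq,
    volume_cube_lt, abs_inv]

theorem volume_dual_cube_le {n : ℕ} (A : Euc n →ₗ[ℝ] Euc n) (hA : LinearMap.det A ≠ 0) (r : ℝ) :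
    volume {p : Euc n | ∀ i, |⟪p, A (unitVec i)⟫| ≤ r} =
      ENNReal.ofReal |LinearMap.det A|⁻¹ * ENNReal.ofReal (2 * r) ^ n := by
  have h : {p : Euc n | ∀ i, |⟪p, A (unitVec i)⟫| ≤ r} =
      LinearMap.adjoint A ⁻¹' {a : Euc n | ∀ i, |a i| ≤ r} := by
    ext p; simp only [mem_ofPred_eq, mem_preimage, adjoint_apply_coord]
  rw [h, Measure.addHaar_preimage_linearMap _ (by rwa [det_adjoint_eq]), det_adjoint_eq,
    volume_cube_le, abs_inv]

/-- A compact neighbourhood of the origin is contained in a parallelepiped spanned by some of its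
points. -/
theorem exists_auerbach {n : ℕ} {T : Set (Euc n)} (hT : IsCompact T) (h0 : T ∈ nhds (0 : Euc n)) :
    ∃ A : Euc n →ₗ[ℝ] Euc n, LinearMap.det A ≠ 0 ∧ (∀ i, A (unitVec i) ∈ T) ∧
      ∀ w ∈ T, ∃ a : Euc n, w = A a ∧ ∀ i, |a i| ≤ 1 := by
  classical
  set b := (EuclideanSpace.basisFun (Fin n) ℝ).toBasis with hb
  have hbi : ∀ i, b i = unitVec i := fun i => by simp [hb]
  have hcont : Continuous fun v : Fin n → Euc n => |b.det v| := by
    have h : (fun v : Fin n → Euc n => |b.det v|) = fun v => |(b.toMatrix v).det| := by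
      ext v; rw [Module.Basis.det_apply]
    rw [h]
    refine (Continuous.matrix_det ?_).abs
    refine continuous_matrix fun i j => ?_
    simp only [Module.Basis.toMatrix_apply, hb, OrthonormalBasis.coe_toBasis_repr_apply,
      EuclideanSpace.basisFun_repr]
    fun_prop
  have hTpi : IsCompact (Set.univ.pi fun _ : Fin n => T) := isCompact_univ_pi fun _ => hT
  obtain ⟨v, hvT, hmax⟩ := hTpi.exists_isMaxOn ⟨fun _ => 0, fun _ _ => mem_of_mem_nhds h0⟩
    hcont.continuousOn
  have hdet : b.det v ≠ 0 := by
    obtain ⟨t, ht0, ht⟩ : ∃ t : ℝ, 0 < t ∧ ∀ i, t • b i ∈ T := by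
      have : ∀ i, ∀ᶠ t : ℝ in nhds 0, t • b i ∈ T := fun i => by
        have hc : Filter.Tendsto (fun t : ℝ => t • b i) (nhds 0) (nhds 0) := by
          have : Continuous fun t : ℝ => t • b i := by fun_prop
          simpa using this.tendsto 0
        exact hc h0
      have h1 := Filter.eventually_all.2 this
      obtain ⟨t, ht⟩ := ((h1.filter_mono nhdsWithin_le_nhds).and
        (self_mem_nhdsWithin : Ioi (0 : ℝ) ∈ nhdsWithin 0 (Ioi 0))).exists
      exact ⟨t, ht.2, ht.1⟩
    have h2 : |b.det fun i => t • b i| ≤ |b.det v| := hmax fun i _ => ht i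
    have h3 : (b.det fun i => t • b i) = t ^ n := by
      have := b.det.map_smul_univ (fun _ => t) b
      simp only [Module.Basis.det_self] at this
      simpa using this
    rw [h3] at h2
    intro h
    rw [h, abs_zero] at h2
    have := pow_pos ht0 n
    linarith [abs_of_pos this]
  obtain ⟨hli, hsp⟩ := (Module.Basis.is_basis_iff_det b).2 (isUnit_iff_ne_zero.2 hdet)
  set v' := Module.Basis.mk hli hsp.ge with hv'
  set A := b.constr ℝ v with hA
  have hAe : ∀ i, A (unitVec i) = v i := fun i => by rw [← hbi, hA, Module.Basis.constr_basis]
  refine ⟨A, ?_, fun i => ?_, fun w hw => ?_⟩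
  · have := Module.Basis.det_comp b A b
    rw [Module.Basis.det_self, mul_one] at this
    rw [← this]
    convert hdet using 2
    ext1 i
    simp [hA]
  · rw [hAe]; exact hvT i trivial
  · refine ⟨WithLp.toLp 2 (v'.repr w), ?_, fun i => ?_⟩
    · rw [linearMap_apply_eq_sum]
      conv_lhs => rw [← v'.sum_repr w]
      simp [hAe, hv']
    · have h1 : b.det (Function.update v i w) = v'.repr w i * b.det v := by
        conv_lhs => rw [← v'.sum_repr w]
        have h2 := map_sum (b.det.toMultilinearMap.toLinearMap v i)
          (fun j => v'.repr w j • v' j) Finset.univ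
        simp only [MultilinearMap.toLinearMap_apply, AlternatingMap.coe_multilinearMap] at h2
        rw [h2, Finset.sum_eq_single i]
        · rw [AlternatingMap.map_update_smul]
          simp [hv']
        · intro j _ hj
          rw [AlternatingMap.map_update_smul]
          have : b.det (Function.update v i (v' j)) = 0 := by
            have := b.det.map_update_self v hj.symm
            simpa [hv'] using this
          rw [this, smul_zero]
        · simp
      have h2 : |b.det (Function.update v i w)| ≤ |b.det v| := by
        refine hmax fun j _ => ?_
        rcases eq_or_ne j i with rfl | h
        · simpa using hw
        · simpa [h] using hvT j trivial
      rw [h1, abs_mul] at h2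
      have h3 := abs_pos.2 hdet
      exact le_of_mul_le_mul_right (by simpa using h2) h3

theorem continuousOn_integrableOn_of_isBounded {n : ℕ} {S : Set (Euc n)}
    (hSb : Bornology.IsBounded S) {φ : Euc n → ℝ} (hφ : Continuous φ) : IntegrableOn φ S :=
  (hφ.continuousOn.integrableOn_compact hSb.isCompact_closure).mono_set subset_closure

/-- Half-space estimate for a convex set whose barycentre is `c`. -/
theorem barycentre_halfspace {n : ℕ} {S : Set (Euc n)} (hSo : IsOpen S) (hSc : Convex ℝ S)
    (hSb : Bornology.IsBounded S) {c : Euc n} (hc : ∀ f : Euc n, ∫ x in S, ⟪f, x - c⟫ = 0)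
    {f x : Euc n} {β : ℝ} (hx : x ∈ S) (hβ : ∀ w ∈ S, ⟪f, w - c⟫ < β) :
    0 < β ∧ -(2 ^ (n + 1) * β) < ⟪f, x - c⟫ := by
  have hcf : Continuous fun w : Euc n => ⟪f, w - c⟫ := by fun_prop
  have hfin : volume S ≠ ⊤ := hSb.measure_lt_top.ne
  have hpos : 0 < volume.real S :=
    ENNReal.toReal_pos (hSo.measure_pos _ ⟨x, hx⟩).ne' hfin
  have hcφ : Continuous fun w : Euc n => β - ⟪f, w - c⟫ := by fun_prop
  have hint := continuousOn_integrableOn_of_isBounded hSb hcφ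
  have hI : ∫ w in S, (β - ⟪f, w - c⟫) = β * volume.real S := by
    rw [integral_sub (f := fun _ => β) (integrableOn_const hfin)
      (continuousOn_integrableOn_of_isBounded hSb hcf), hc f]
    simp [mul_comm]
  have hnn : 0 ≤ᵐ[volume.restrict S] fun w : Euc n => β - ⟪f, w - c⟫ := by
    filter_upwards [ae_restrict_mem hSo.measurableSet] with w hw
    exact (sub_pos.2 (hβ w hw)).le
  have hβ0 : 0 < β := by
    have h1 : 0 < ∫ w in S, (β - ⟪f, w - c⟫) := by
      rw [setIntegral_pos_iff_support_of_nonneg_ae hnn hint]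
      have : Function.support (fun w : Euc n => β - ⟪f, w - c⟫) ∩ S = S :=
        inter_eq_right.2 fun w hw => (sub_pos.2 (hβ w hw)).ne'
      rw [this]
      exact hSo.measure_pos _ ⟨x, hx⟩
    rw [hI] at h1
    exact pos_of_mul_pos_left h1 hpos.le
  refine ⟨hβ0, ?_⟩
  by_contra! hcon
  set S' := AffineMap.homothety x (1 / 2 : ℝ) '' S with hS'
  have hS'S : S' ⊆ S := by
    rintro _ ⟨w, hw, rfl⟩
    rw [AffineMap.homothety_apply, vsub_eq_sub, vadd_eq_add]
    have := hSc hx hw (by norm_num : (0 : ℝ) ≤ 1 / 2) (by norm_num : (0 : ℝ) ≤ 1 / 2) (by norm_num)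
    convert this using 1
    module
  have hS'o : IsOpen S' := AffineMap.homothety_isOpenMap x _ (by norm_num) _ hSo
  have hvol : volume.real S' = (1 / 2) ^ n * volume.real S := by
    rw [Measure.real, hS', Measure.addHaar_image_homothety, ENNReal.toReal_mul]
    simp [Measure.real]
  have h2 : (β + (2 ^ (n + 1) * β - β) / 2) * volume.real S' ≤ ∫ w in S', (β - ⟪f, w - c⟫) := by
    have := setIntegral_mono_on (μ := volume) (s := S')
      (f := fun _ => β + (2 ^ (n + 1) * β - β) / 2)
      (g := fun w => β - ⟪f, w - c⟫) (integrableOn_const (measure_ne_top_of_subset hS'S hfin))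
      (hint.mono_set hS'S) hS'o.measurableSet ?_
    · simpa [mul_comm] using this
    · rintro _ ⟨w, hw, rfl⟩
      have h3 : ⟪f, AffineMap.homothety x (1 / 2 : ℝ) w - c⟫ =
          (1 / 2) * ⟪f, w - c⟫ + (1 / 2) * ⟪f, x - c⟫ := by
        rw [← inner_smul_right, ← inner_smul_right, ← inner_add_right, AffineMap.homothety_apply,
          vsub_eq_sub, vadd_eq_add]
        congr 1
        module
      have := hβ w hw
      simp only [h3]
      linarith
  have h4 : ∫ w in S', (β - ⟪f, w - c⟫) ≤ ∫ w in S, (β - ⟪f, w - c⟫) :=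
    setIntegral_mono_set hint hnn hS'S.eventuallyLE
  rw [hI] at h4
  rw [hvol] at h2
  have h5 : (1 / 2 : ℝ) ^ n * 2 ^ (n + 1) = 2 := by
    rw [pow_succ, ← mul_assoc, ← mul_pow]; norm_num
  have h6 : (0 : ℝ) < (1 / 2) ^ n := by positivity
  have h7 : (β + (2 ^ (n + 1) * β - β) / 2) * ((1 / 2) ^ n * volume.real S) =
      β * volume.real S + (1 / 2) ^ n * β * volume.real S / 2 := by
    linear_combination (β * volume.real S / 2) * h5
  have h8 : 0 < (1 / 2 : ℝ) ^ n * β * volume.real S := by positivity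
  linarith

theorem barycentre_mem {n : ℕ} {S : Set (Euc n)} (hSo : IsOpen S) (hSc : Convex ℝ S)
    (hSb : Bornology.IsBounded S) (hne : S.Nonempty)
    {c : Euc n} (hc : ∀ f : Euc n, ∫ x in S, ⟪f, x - c⟫ = 0) : c ∈ S := by
  by_contra h
  obtain ⟨L, hL⟩ := geometric_hahn_banach_open_point hSc hSo h
  obtain ⟨x, hx⟩ := hne
  refine lt_irrefl (0 : ℝ) (barycentre_halfspace hSo hSc hSb hc
    (f := (InnerProductSpace.toDual ℝ (Euc n)).symm L) hx fun w hw => ?_).1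
  rw [InnerProductSpace.toDual_symm_apply, map_sub]
  exact sub_neg.2 (hL w hw)

/-- A convex body is balanced about its barycentre, up to a dimensional constant. -/
theorem barycentre_balanced {n : ℕ} {S : Set (Euc n)} (hSo : IsOpen S) (hSc : Convex ℝ S)
    (hSb : Bornology.IsBounded S)
    {c : Euc n} (hc : ∀ f : Euc n, ∫ x in S, ⟪f, x - c⟫ = 0) {x : Euc n} (hx : x ∈ S) :
    c - (2 ^ (n + 1) : ℝ)⁻¹ • (x - c) ∈ S := by
  by_contra h
  obtain ⟨L, hL⟩ := geometric_hahn_banach_open_point hSc hSo h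
  have h1 := (barycentre_halfspace hSo hSc hSb hc
    (f := (InnerProductSpace.toDual ℝ (Euc n)).symm L) (β := -(2 ^ (n + 1) : ℝ)⁻¹ * L (x - c))
    hx fun w hw => ?_).2
  · rw [InnerProductSpace.toDual_symm_apply] at h1
    have : (2 ^ (n + 1) * (-(2 ^ (n + 1) : ℝ)⁻¹ * L (x - c))) = - L (x - c) := by
      field_simp
    linarith
  · rw [InnerProductSpace.toDual_symm_apply, map_sub]
    have := hL w hw
    rw [map_sub, map_smul, smul_eq_mul] at this
    linarith

/-- The dilation about `c` by the factor `θ` of the closure of `S`. -/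
def dilate {n : ℕ} (S : Set (Euc n)) (c : Euc n) (θ : ℝ) : Set (Euc n) :=
  (fun w => c + θ • (w - c)) '' closure S

/-- The open convex set `S` is comparable to the parallelepiped with centre `c` spanned by the
columns of `A`, and almost symmetric about `c`, with constant `C`. -/
structure IsNormalized {n : ℕ} (S : Set (Euc n)) (c : Euc n) (A : Euc n →ₗ[ℝ] Euc n) (C : ℝ) :
    Prop where
  isOpen : IsOpen S
  convex : Convex ℝ S
  bounded : Bornology.IsBounded S
  mem : c ∈ S
  det_ne : LinearMap.det A ≠ 0
  edge : ∀ i, c + A (unitVec i) ∈ closure S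
  opposite : ∀ i, c - C⁻¹ • A (unitVec i) ∈ closure S
  cover : ∀ x ∈ closure S, ∃ a : Euc n, x = c + A a ∧ ∀ i, |a i| ≤ 1

theorem exists_isNormalized {n : ℕ} {S : Set (Euc n)} (hSo : IsOpen S) (hSc : Convex ℝ S)
    (hSb : Bornology.IsBounded S) (hne : S.Nonempty)
    {c : Euc n} (hc : ∀ f : Euc n, ∫ x in S, ⟪f, x - c⟫ = 0) :
    ∃ A, IsNormalized S c A (2 ^ (n + 1)) := by
  have hcS := barycentre_mem hSo hSc hSb hne hc
  have hT : IsCompact ((fun x => x - c) '' closure S) :=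
    hSb.isCompact_closure.image (by fun_prop)
  have hT0 : (fun x => x - c) '' closure S ∈ nhds (0 : Euc n) := by
    have h1 : S ∈ nhds c := hSo.mem_nhds hcS
    have h2 : Filter.Tendsto (fun y : Euc n => y + c) (nhds 0) (nhds c) := by
      have : Continuous fun y : Euc n => y + c := by fun_prop
      simpa using this.tendsto 0
    filter_upwards [h2 h1] with y hy
    exact ⟨y + c, subset_closure hy, by simp⟩
  obtain ⟨A, hdet, hedge, hcov⟩ := exists_auerbach hT hT0
  have hedge' : ∀ i, c + A (unitVec i) ∈ closure S := fun i => by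
    obtain ⟨x, hx, hxe⟩ := hedge i
    rw [← hxe]; simpa using hx
  refine ⟨A, hSo, hSc, hSb, hcS, hdet, hedge', fun i => ?_, fun x hx => ?_⟩
  · have hmap : MapsTo (fun x => c - (2 ^ (n + 1) : ℝ)⁻¹ • (x - c)) S S :=
      fun x hx => barycentre_balanced hSo hSc hSb hc hx
    have := hmap.closure (by fun_prop) (hedge' i)
    simpa using this
  · obtain ⟨a, ha, ha1⟩ := hcov (x - c) ⟨x, hx, rfl⟩
    exact ⟨a, by rw [← ha]; simp, ha1⟩

namespace IsNormalized

variable {n : ℕ} {S : Set (Euc n)} {c : Euc n} {A : Euc n →ₗ[ℝ] Euc n} {C : ℝ}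

theorem add_mem_dilate (h : IsNormalized S c A C) {θ η : ℝ} (hθ : 0 < θ) (hη : 0 ≤ η)
    {x w : Euc n} (hx : x ∈ dilate S c θ) (hw : w ∈ closure S) :
    x + η • (w - c) ∈ dilate S c (θ + η) := by
  obtain ⟨u, hu, rfl⟩ := hx
  have hp : 0 < θ + η := by linarith
  refine ⟨(θ / (θ + η)) • u + (η / (θ + η)) • w,
    h.convex.closure hu hw (by positivity) (by positivity) (by field_simp), ?_⟩
  have h1 : (θ + η) * (θ / (θ + η)) = θ := by field_simp
  have h2 : (θ + η) * (η / (θ + η)) = η := by field_simp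
  simp only [smul_sub, smul_add, smul_smul, h1, h2]
  module

theorem dilate_mono (h : IsNormalized S c A C) {θ θ' : ℝ} (hθ : 0 < θ) (hθ' : θ ≤ θ') :
    dilate S c θ ⊆ dilate S c θ' := fun x hx => by
  have := h.add_mem_dilate hθ (sub_nonneg.2 hθ') hx (subset_closure h.mem)
  simpa using this

theorem dilate_subset (h : IsNormalized S c A C) {θ : ℝ} (hθ : 0 < θ) (hθ1 : θ < 1) :
    dilate S c θ ⊆ S := by
  rintro _ ⟨w, hw, rfl⟩
  have := h.convex.combo_interior_closure_mem_interior (x := c) (y := w)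
    (by rw [h.isOpen.interior_eq]; exact h.mem) hw (a := 1 - θ) (b := θ) (by linarith) hθ.le
    (by ring)
  rw [h.isOpen.interior_eq] at this
  convert this using 1
  module

theorem isCompact_dilate (h : IsNormalized S c A C) (θ : ℝ) : IsCompact (dilate S c θ) :=
  h.bounded.isCompact_closure.image (by fun_prop)

theorem add_cube_mem_dilate (h : IsNormalized S c A C) (hn : 0 < n) (hC : 1 ≤ C) {θ η : ℝ}
    (hθ : 0 < θ) (hη : 0 < η) {x a : Euc n} (hx : x ∈ dilate S c θ)
    (ha : ∀ i, |a i| ≤ η / (C * n)) : x + A a ∈ dilate S c (θ + η) := by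
  have hn' : (0 : ℝ) < n := by exact_mod_cast hn
  have hC0 : 0 < C := by linarith
  have hw : ∀ i, c + (n * a i / η) • A (unitVec i) ∈ closure S := fun i => by
    have ht : |n * a i / η| ≤ C⁻¹ := by
      rw [abs_div, abs_mul, abs_of_pos hη, abs_of_pos hn', div_le_iff₀ hη]
      calc n * |a i| ≤ n * (η / (C * n)) := by gcongr; exact ha i
        _ = C⁻¹ * η := by field_simp
    obtain ⟨h1, h2⟩ := abs_le.1 ht
    set t := n * a i / η
    have hCi : C⁻¹ ≤ 1 := inv_le_one_of_one_le₀ hC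
    have hCp : 0 < C⁻¹ := inv_pos.2 hC0
    have := h.convex.closure (h.edge i) (h.opposite i)
      (a := (t + C⁻¹) / (1 + C⁻¹)) (b := (1 - t) / (1 + C⁻¹))
      (div_nonneg (by linarith) (by linarith)) (div_nonneg (by linarith) (by linarith))
      (by field_simp; ring)
    convert this using 1
    have e1 : (t + C⁻¹) / (1 + C⁻¹) + (1 - t) / (1 + C⁻¹) = 1 := by field_simp; ring
    have e2 : (t + C⁻¹) / (1 + C⁻¹) - (1 - t) / (1 + C⁻¹) * C⁻¹ = t := by field_simp; ring
    set α := (t + C⁻¹) / (1 + C⁻¹)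
    set β := (1 - t) / (1 + C⁻¹)
    calc c + t • A (unitVec i) = (α + β) • c + (α - β * C⁻¹) • A (unitVec i) := by
          rw [e1, e2, one_smul]
      _ = _ := by module
  have hW : ∑ i : Fin n, (1 / n : ℝ) • (c + (n * a i / η) • A (unitVec i)) ∈ closure S :=
    h.convex.closure.sum_mem (fun _ _ => by positivity) (by simp [hn'.ne']) fun i _ => hw i
  have := h.add_mem_dilate hθ hη.le hx hW
  convert this using 2
  rw [linearMap_apply_eq_sum]
  simp only [smul_add, Finset.sum_add_distrib, smul_smul]
  have h3 : ∑ _i : Fin n, (1 / n : ℝ) • c = c := by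
    rw [Finset.sum_const, Finset.card_univ, Fintype.card_fin, ← Nat.cast_smul_eq_nsmul ℝ, smul_smul]
    rw [mul_one_div_cancel hn'.ne', one_smul]
  rw [h3, add_sub_cancel_left, Finset.smul_sum]
  refine Finset.sum_congr rfl fun i _ => ?_
  rw [smul_smul]
  congr 1
  field_simp

end IsNormalized

theorem volume_image_cube {n : ℕ} (A : Euc n →ₗ[ℝ] Euc n) (x : Euc n) (ρ : ℝ) :
    volume ((fun a => x + A a) '' {a : Euc n | ∀ i, |a i| ≤ ρ}) =
      ENNReal.ofReal |LinearMap.det A| * ENNReal.ofReal (2 * ρ) ^ n := by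
  have : (fun a => x + A a) '' {a : Euc n | ∀ i, |a i| ≤ ρ} =
      (fun y => x + y) '' (A '' {a : Euc n | ∀ i, |a i| ≤ ρ}) := by
    rw [image_image]
  rw [this, image_add_left, measure_preimage_add, Measure.addHaar_image_linearMap, volume_cube_le]

theorem isCompact_cube {n : ℕ} (ρ : ℝ) : IsCompact {a : Euc n | ∀ i, |a i| ≤ ρ} := by
  have h : {a : Euc n | ∀ i, |a i| ≤ ρ} =
      (EuclideanSpace.equiv (Fin n) ℝ).toHomeomorph ⁻¹' (Set.univ.pi fun _ => Icc (-ρ) ρ) := by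
    ext a; simp [abs_le, Pi.le_def, forall_and]
  rw [h, Homeomorph.isCompact_preimage]
  exact isCompact_univ_pi fun _ => isCompact_Icc

/-- On a symmetric parallelepiped about `x`, a convex function exceeds its value at `x` on at least
half of the volume. -/
theorem volume_cube_le_two_mul {n : ℕ} {Ω : Set (Euc n)} {v : Euc n → ℝ} (hconv : ConvexOn ℝ Ω v)
    (A : Euc n →ₗ[ℝ] Euc n) (x : Euc n) (ρ : ℝ)
    (hX : (fun a => x + A a) '' {a : Euc n | ∀ i, |a i| ≤ ρ} ⊆ Ω) :
    ENNReal.ofReal |LinearMap.det A| * ENNReal.ofReal (2 * ρ) ^ n ≤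
      2 * volume {y ∈ (fun a => x + A a) '' {a : Euc n | ∀ i, |a i| ≤ ρ} | v x ≤ v y} := by
  set X := (fun a => x + A a) '' {a : Euc n | ∀ i, |a i| ≤ ρ} with hXdef
  set H := {y ∈ X | v x ≤ v y} with hH
  have hsymm : ∀ y ∈ X, (2 : ℝ) • x - y ∈ X := by
    rintro _ ⟨a, ha, rfl⟩
    refine ⟨-a, fun i => by simpa using ha i, ?_⟩
    simp only [map_neg]
    module
  have hcover : X ⊆ H ∪ (fun y => (2 : ℝ) • x - y) ⁻¹' H := by
    intro y hy
    by_contra hcon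
    simp only [mem_union, mem_preimage, hH, mem_ofPred_eq, not_or, not_and, not_le] at hcon
    have h1 := hcon.1 hy
    have h2 := hcon.2 (hsymm y hy)
    have h3 := hconv.2 (hX hy) (hX (hsymm y hy)) (by norm_num : (0 : ℝ) ≤ 1 / 2)
      (by norm_num : (0 : ℝ) ≤ 1 / 2) (by norm_num)
    have h4 : (1 / 2 : ℝ) • y + (1 / 2 : ℝ) • ((2 : ℝ) • x - y) = x := by module
    rw [h4, smul_eq_mul, smul_eq_mul] at h3
    linarith
  rw [← volume_image_cube A x]
  have hpre : volume ((fun y => (2 : ℝ) • x - y) ⁻¹' H) = volume H :=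
    (Measure.measurePreserving_sub_left volume ((2 : ℝ) • x)).measure_preimage_equiv
      (f := MeasurableEquiv.subLeft ((2 : ℝ) • x)) H
  calc volume X ≤ volume (H ∪ (fun y => (2 : ℝ) • x - y) ⁻¹' H) := measure_mono hcover
    _ ≤ volume H + volume ((fun y => (2 : ℝ) • x - y) ⁻¹' H) := measure_union_le _ _
    _ = 2 * volume H := by rw [hpre, two_mul]

/-- The lower bound on the Monge–Ampère measure controls `v` on a smaller dilate by its maximum on a
larger one. -/
theorem IsNormalized.rpow_mul_le {n : ℕ} (hn : 0 < n) {q lam Lam : ℝ} (hq0 : 0 ≤ q) (hlam : 0 < lam)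
    {Ω : Set (Euc n)} {v : Euc n → ℝ} (hv : GenSol n q lam Lam Ω v)
    {S : Set (Euc n)} {c : Euc n} {A : Euc n →ₗ[ℝ] Euc n} {C : ℝ} (hS : IsNormalized S c A C)
    (hC : 1 ≤ C) (hSΩ : S ⊆ Ω) {θ η : ℝ} (hθ : 0 < θ) (hη : 0 < η) (hθη : θ + 2 * η < 1)
    {P : Euc n} (hP : P ∈ dilate S c θ) (hvP : 0 < v P) {Y : ℝ}
    (hY : ∀ x ∈ dilate S c (θ + 2 * η), v x ≤ Y) :
    lam * v P ^ q * (|LinearMap.det A| * (2 * (η / (C * n))) ^ n) ≤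
      2 * (|LinearMap.det A|⁻¹ * (2 * (Y * C / η)) ^ n) := by
  obtain ⟨hcont, hconv, hnn, -, hlow⟩ := hv
  have hC0 : 0 < C := by linarith
  have hd : 0 < |LinearMap.det A| := abs_pos.2 hS.det_ne
  have hDΩ : dilate S c (θ + 2 * η) ⊆ Ω := (hS.dilate_subset (by linarith) hθη).trans hSΩ
  have hEE : dilate S c (θ + η) ⊆ dilate S c (θ + 2 * η) :=
    hS.dilate_mono (by linarith) (by linarith)
  have hY0 : 0 ≤ Y := hvP.le.trans (hY P (hS.dilate_mono hθ (by linarith) hP))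
  set X := (fun a => P + A a) '' {a : Euc n | ∀ i, |a i| ≤ η / (C * n)} with hX
  have hXE : X ⊆ dilate S c (θ + η) := by
    rintro _ ⟨a, ha, rfl⟩
    exact hS.add_cube_mem_dilate hn hC hθ hη hP ha
  have hXc : IsCompact X := (isCompact_cube _).image (by
    have := A.continuous_of_finiteDimensional
    fun_prop)
  set H := {y ∈ X | v P ≤ v y} with hH
  have hHm : MeasurableSet H := by
    have : IsClosed (X ∩ v ⁻¹' Ici (v P)) :=
      (hcont.mono (hXE.trans (hEE.trans hDΩ))).preimage_isClosed_of_isClosed hXc.isClosed isClosed_Ici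
    exact this.measurableSet
  have hhalf := volume_cube_le_two_mul hconv A P (η / (C * n)) (hXE.trans (hEE.trans hDΩ))
  have h1 := hlow (dilate S c (θ + η)) (hS.isCompact_dilate _).isClosed.measurableSet
    (hEE.trans hDΩ)
  have hsub : H ⊆ dilate S c (θ + η) ∩ {x | 0 < v x} :=
    fun x hx => ⟨hXE hx.1, hvP.trans_le hx.2⟩
  have h2 : ENNReal.ofReal (v P ^ q) * volume H ≤
      ∫⁻ x in dilate S c (θ + η) ∩ {x | 0 < v x}, ENNReal.ofReal (v x ^ q) := by
    calc ENNReal.ofReal (v P ^ q) * volume H = ∫⁻ _ in H, ENNReal.ofReal (v P ^ q) := by simp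
      _ ≤ ∫⁻ x in H, ENNReal.ofReal (v x ^ q) := setLIntegral_mono' hHm fun x hx =>
          ENNReal.ofReal_le_ofReal (Real.rpow_le_rpow hvP.le hx.2 hq0)
      _ ≤ _ := lintegral_mono_set hsub
  have h3 : subgradImg Ω v (dilate S c (θ + η) ∩ {x | 0 < v x}) ⊆
      {p : Euc n | ∀ i, |⟪p, A (unitVec i)⟫| ≤ Y * C / η} := by
    intro p hp i
    simp only [subgradImg, mem_iUnion] at hp
    obtain ⟨x, ⟨hx, hx0⟩, hpx⟩ := hp
    have hx0' : 0 < v x := hx0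
    have e1 := hS.add_mem_dilate (by linarith) hη.le hx (hS.edge i)
    have e2 := hS.add_mem_dilate (by linarith) hη.le hx (hS.opposite i)
    rw [show θ + η + η = θ + 2 * η by ring] at e1 e2
    have f1 := hpx _ (hDΩ e1)
    have f2 := hpx _ (hDΩ e2)
    have g1 := hY _ e1
    have g2 := hY _ e2
    simp only [add_sub_cancel_left, sub_sub_cancel_left, inner_smul_right, inner_neg_right]
      at f1 f2 g1 g2
    set t := ⟪p, A (unitVec i)⟫
    have k1 : t * η ≤ Y := by linarith [mul_comm t η]
    have k2 : -t * η ≤ Y * C := by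
      have : η * (C⁻¹ * t) * C = t * η := by field_simp
      nlinarith
    have k3 : t * η ≤ Y * C := k1.trans (le_mul_of_one_le_right hY0 hC)
    exact abs_le'.2 ⟨(le_div_iff₀ hη).2 k3, (le_div_iff₀ hη).2 k2⟩
  have h4 : volume (subgradImg Ω v (dilate S c (θ + η) ∩ {x | 0 < v x})) ≤
      ENNReal.ofReal |LinearMap.det A|⁻¹ * ENNReal.ofReal (2 * (Y * C / η)) ^ n :=
    (measure_mono h3).trans_eq (volume_dual_cube_le A hS.det_ne _)
  have h5 : ENNReal.ofReal lam * ENNReal.ofReal (v P ^ q) *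
      (ENNReal.ofReal |LinearMap.det A| * ENNReal.ofReal (2 * (η / (C * n))) ^ n) ≤
      2 * (ENNReal.ofReal |LinearMap.det A|⁻¹ * ENNReal.ofReal (2 * (Y * C / η)) ^ n) := by
    calc _ ≤ ENNReal.ofReal lam * ENNReal.ofReal (v P ^ q) * (2 * volume H) := by gcongr
      _ = 2 * (ENNReal.ofReal lam * (ENNReal.ofReal (v P ^ q) * volume H)) := by ring
      _ ≤ _ := mul_le_mul_right (((mul_le_mul_right h2 _).trans h1).trans h4) 2
  have hvq : 0 ≤ v P ^ q := Real.rpow_nonneg hvP.le q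
  have hR : 0 ≤ 2 * (|LinearMap.det A|⁻¹ * (2 * (Y * C / η)) ^ n) := by positivity
  have hpos1 : (0 : ℝ) ≤ 2 * (η / (C * n)) := by positivity
  have hpos2 : (0 : ℝ) ≤ 2 * (Y * C / η) := by positivity
  refine (ENNReal.ofReal_le_ofReal_iff hR).1 ?_
  rw [ENNReal.ofReal_mul (mul_nonneg hlam.le hvq), ENNReal.ofReal_mul hlam.le,
    ENNReal.ofReal_mul hd.le, ENNReal.ofReal_pow hpos1, ENNReal.ofReal_mul (q := |LinearMap.det A|⁻¹ * (2 * (Y * C / η)) ^ n) zero_le_two,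
    ENNReal.ofReal_mul (inv_nonneg.2 hd.le), ENNReal.ofReal_pow hpos2, ENNReal.ofReal_ofNat]
  exact h5
/-- An affine function lying below `v` on the boundary of `S` and touching `v` at a point of `S`
can be translated to a supporting function at a point of `S`. -/
theorem mem_subgradImg_of_lt {n : ℕ} {Ω S : Set (Euc n)} {v : Euc n → ℝ} (hcont : ContinuousOn v Ω)
    (hconv : ConvexOn ℝ Ω v) (hSo : IsOpen S) (hSb : Bornology.IsBounded S) (hcl : closure S ⊆ Ω)
    {x₁ : Euc n} (hx₁ : x₁ ∈ S) {p : Euc n}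
    (hp : ∀ x ∈ closure S, x ∉ S → v x₁ + ⟪p, x - x₁⟫ < v x) : p ∈ subgradImg Ω v S := by
  obtain ⟨x, hx, hmin⟩ := hSb.isCompact_closure.exists_isMinOn ⟨x₁, subset_closure hx₁⟩
    (f := fun x => v x - ⟪p, x⟫)
    ((hcont.mono hcl).sub (Continuous.continuousOn (by fun_prop)))
  have hxS : x ∈ S := by
    by_contra hxS
    have h1 := hp x hx hxS
    have h2 := hmin (subset_closure hx₁)
    simp only [mem_ofPred_eq, inner_sub_right] at h1 h2
    linarith
  have hcv : ConvexOn ℝ Ω fun x => v x - ⟪p, x⟫ :=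
    hconv.sub ((innerₛₗ ℝ p).concaveOn hconv.1)
  have hloc : IsLocalMinOn (fun x => v x - ⟪p, x⟫) Ω x :=
    (((hmin.on_subset subset_closure).localize).isLocalMin
      (hSo.mem_nhds hxS)).on Ω
  have hglob := IsMinOn.of_isLocalMinOn_of_convexOn (hcl hx) hloc hcv
  refine mem_iUnion₂.2 ⟨x, hxS, fun y hy => ?_⟩
  have := hglob hy
  simp only [mem_ofPred_eq] at this
  rw [inner_sub_right]
  linarith

theorem exists_coord_diff {n : ℕ} {S : Set (Euc n)} {c : Euc n} {A : Euc n →ₗ[ℝ] Euc n} {C : ℝ}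
    (hS : IsNormalized S c A C) {x y : Euc n} (hx : x ∈ closure S) (hy : y ∈ closure S)
    (p : Euc n) : ∃ a : Euc n, (∀ i, |a i| ≤ 2) ∧
      ⟪p, x - y⟫ = ∑ i, a i * ⟪p, A (unitVec i)⟫ := by
  obtain ⟨a, rfl, ha⟩ := hS.cover x hx
  obtain ⟨b, rfl, hb⟩ := hS.cover y hy
  refine ⟨a - b, fun i => ?_, ?_⟩
  · have := abs_sub (a i) (b i)
    simp only [PiLp.sub_apply]
    linarith [ha i, hb i]
  · rw [add_sub_add_left_eq_sub, ← map_sub, linearMap_apply_eq_sum, inner_sum]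
    simp [inner_smul_right]

/-- Many disjoint translates of a parallelepiped of slopes are attained by `v` on a section that
reaches much further in one direction than in the opposite one. -/
theorem IsNormalized.card_mul_le {n : ℕ} (hn : 0 < n) {q lam Lam : ℝ} (hq0 : 0 ≤ q)
    (hLam : 0 ≤ Lam) {Ω : Set (Euc n)} {v : Euc n → ℝ} (hv : GenSol n q lam Lam Ω v)
    {S : Set (Euc n)} {c : Euc n} {A : Euc n →ₗ[ℝ] Euc n} {C : ℝ} (hS : IsNormalized S c A C)
    (hcl : closure S ⊆ Ω) {x₁ x₂ p₀ f : Euc n} {h s M : ℝ} {N : ℕ} (hx₁ : x₁ ∈ S) (hx₂ : x₂ ∈ S)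
    (hv₁ : v x₁ = 0) (hh : 0 < h) (hs : 0 < s) (hN : 0 < N)
    (hbd : ∀ x ∈ closure S, x ∉ S → ⟪p₀, x - x₁⟫ + h ≤ v x)
    (hf : ∀ x ∈ closure S, ⟪f, x - x₁⟫ ≤ s / (4 * N)) (hf₂ : ⟪f, x₂ - x₁⟫ ≤ -s / 2)
    (hM : ∀ x ∈ S, v x ≤ M) :
    N * (|LinearMap.det A|⁻¹ * (2 * (h / (4 * n))) ^ n) ≤
      Lam * (M ^ q * (|LinearMap.det A| * (2 * 1) ^ n)) := by
  obtain ⟨hcont, hconv, hnn, hup, -⟩ := hv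
  have hd : 0 < |LinearMap.det A| := abs_pos.2 hS.det_ne
  have hnR : (0 : ℝ) < n := by exact_mod_cast hn
  have hNR : (0 : ℝ) < N := by exact_mod_cast hN
  set r := h / (4 * n) with hr
  have hr0 : 0 < r := by positivity
  have : NeZero n := ⟨hn.ne'⟩
  obtain ⟨i, hi⟩ : ∃ i, s / (4 * n) ≤ |⟪f, A (unitVec i)⟫| := by
    by_contra! hcon
    obtain ⟨a, ha, hae⟩ := exists_coord_diff hS (subset_closure hx₂) (subset_closure hx₁) f
    have h1 : -⟪f, x₂ - x₁⟫ < ∑ _i : Fin n, 2 * (s / (4 * n)) := by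
      rw [hae, ← Finset.sum_neg_distrib]
      refine Finset.sum_lt_sum_of_nonempty Finset.univ_nonempty fun j _ => ?_
      refine (neg_le_abs _).trans_lt ?_
      rw [abs_mul]
      exact (mul_le_mul_of_nonneg_right (ha j) (abs_nonneg _)).trans_lt (by linarith [hcon j])
    have h2 : ∑ _i : Fin n, 2 * (s / (4 * n)) = s / 2 := by
      simp; field_simp; norm_num
    linarith
  set g := ⟪f, A (unitVec i)⟫ with hg
  have hg0 : 0 < |g| := lt_of_lt_of_le (by positivity) hi
  set t : ℕ → ℝ := fun k => k * (2 * r) / |g| with ht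
  set W : ℕ → Set (Euc n) := fun k =>
    (fun p => (p₀ + t k • f) + p) '' {p | ∀ j, |⟪p, A (unitVec j)⟫| < r} with hW
  have hWsub : ∀ k ∈ Finset.range N, W k ⊆ subgradImg Ω v S := by
    rintro k hk _ ⟨p, hp, rfl⟩
    have hkN : (k : ℝ) ≤ N := by exact_mod_cast (Finset.mem_range.1 hk).le
    refine mem_subgradImg_of_lt hcont hconv hS.isOpen hS.bounded hcl hx₁ fun x hx hxS => ?_
    have h1 := hbd x hx hxS
    have h2 : ⟪p, x - x₁⟫ < h / 2 := by
      obtain ⟨a, ha, hae⟩ := exists_coord_diff hS hx (subset_closure hx₁) p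
      have h1 : ⟪p, x - x₁⟫ < ∑ _i : Fin n, 2 * r := by
        rw [hae]
        refine Finset.sum_lt_sum_of_nonempty Finset.univ_nonempty fun j _ => ?_
        refine (le_abs_self _).trans_lt ?_
        rw [abs_mul]
        exact (mul_le_mul_of_nonneg_right (ha j) (abs_nonneg _)).trans_lt (by
          have : |⟪p, A (unitVec j)⟫| < r := hp j
          linarith)
      have h2 : ∑ _i : Fin n, 2 * r = h / 2 := by
        simp [hr]; field_simp; norm_num
      linarith
    have h3 : t k * ⟪f, x - x₁⟫ ≤ h / 2 := by
      have ht0 : 0 ≤ t k := by positivity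
      have ht1 : t k ≤ N * (2 * r) / (s / (4 * n)) := by
        simp only [ht]; gcongr
      calc t k * ⟪f, x - x₁⟫ ≤ t k * (s / (4 * N)) := by gcongr; exact hf x hx
        _ ≤ N * (2 * r) / (s / (4 * n)) * (s / (4 * N)) := by gcongr
        _ = h / 2 := by rw [hr]; field_simp; norm_num
    rw [hv₁, inner_add_left, inner_add_left, real_inner_smul_left]
    linarith
  have hWo : ∀ k, MeasurableSet (W k) := fun k => by
    have : IsOpen {p : Euc n | ∀ j, |⟪p, A (unitVec j)⟫| < r} := by
      simp only [ofPred_forall]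
      exact isOpen_iInter_of_finite fun j => isOpen_lt (by fun_prop) continuous_const
    exact ((Homeomorph.addLeft (p₀ + t k • f)).isOpenMap _ this).measurableSet
  have hdisj : ∀ j k : ℕ, j < k → Disjoint (W j) (W k) := by
    intro j k hjk
    rw [Set.disjoint_left]
    rintro _ ⟨p, hp, rfl⟩ ⟨p', hp', he⟩
    have e1 : p - p' = (t k - t j) • f := by
      have e := congrArg (fun z => z - p' - p₀ - t j • f) he
      simp only at e
      rw [sub_smul]
      have : p - p' = p₀ + t j • f + p - p' - p₀ - t j • f := by abel
      rw [this, ← e]; abel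
    have e2 := congrArg (fun z => ⟪z, A (unitVec i)⟫) e1
    simp only [inner_sub_left, real_inner_smul_left] at e2
    have e3 : |⟪p, A (unitVec i)⟫ - ⟪p', A (unitVec i)⟫| < 2 * r := by
      have := abs_sub ⟪p, A (unitVec i)⟫ ⟪p', A (unitVec i)⟫
      have h1 : |⟪p, A (unitVec i)⟫| < r := hp i
      have h2 : |⟪p', A (unitVec i)⟫| < r := hp' i
      linarith
    have hjk' : (j : ℝ) + 1 ≤ k := by exact_mod_cast hjk
    have e4 : (t k - t j) * |g| = (k - j) * (2 * r) := by
      simp only [ht]; field_simp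
    rw [e2, ← hg, abs_mul] at e3
    have e5 : (t k - t j) * |g| ≤ |t k - t j| * |g| := by gcongr; exact le_abs_self _
    nlinarith
  have hpw : Set.PairwiseDisjoint (Finset.range N : Set ℕ) W := by
    intro j _ k _ hjk
    rcases lt_or_gt_of_ne hjk with h1 | h1
    · exact hdisj _ _ h1
    · exact (hdisj _ _ h1).symm
  have hvol : (N : ENNReal) * (ENNReal.ofReal |LinearMap.det A|⁻¹ * ENNReal.ofReal (2 * r) ^ n) ≤
      volume (subgradImg Ω v S) := by
    calc _ = ∑ k ∈ Finset.range N, volume (W k) := by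
          simp only [hW, image_add_left, measure_preimage_add,
            volume_dual_cube_lt A hS.det_ne, Finset.sum_const, Finset.card_range, nsmul_eq_mul]
      _ = volume (⋃ k ∈ Finset.range N, W k) :=
          (measure_biUnion_finset hpw fun k _ => hWo k).symm
      _ ≤ _ := measure_mono (iUnion₂_subset hWsub)
  have hSvol : volume S ≤ ENNReal.ofReal |LinearMap.det A| * ENNReal.ofReal (2 * 1) ^ n := by
    rw [← volume_image_cube A c]
    refine measure_mono fun x hx => ?_
    obtain ⟨a, rfl, ha⟩ := hS.cover x (subset_closure hx)
    exact ⟨a, ha, rfl⟩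
  have hSΩ : S ⊆ Ω := subset_closure.trans hcl
  have hint : ∫⁻ x in S ∩ {x | 0 < v x}, ENNReal.ofReal (v x ^ q) ≤
      ENNReal.ofReal (M ^ q) * volume S := by
    calc _ ≤ ∫⁻ x in S, ENNReal.ofReal (v x ^ q) := lintegral_mono_set inter_subset_left
      _ ≤ ∫⁻ _ in S, ENNReal.ofReal (M ^ q) :=
        setLIntegral_mono' hS.isOpen.measurableSet fun x hx =>
          ENNReal.ofReal_le_ofReal (Real.rpow_le_rpow (hnn x (hSΩ hx)) (hM x hx) hq0)
      _ = _ := by simp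
  have hMq : 0 ≤ M ^ q := Real.rpow_nonneg ((hnn _ (hSΩ hx₁)).trans (hM _ hx₁)) q
  have hall : (N : ENNReal) * (ENNReal.ofReal |LinearMap.det A|⁻¹ * ENNReal.ofReal (2 * r) ^ n) ≤
      ENNReal.ofReal Lam * (ENNReal.ofReal (M ^ q) *
        (ENNReal.ofReal |LinearMap.det A| * ENNReal.ofReal (2 * 1) ^ n)) :=
    (hvol.trans (hup S hS.isOpen.measurableSet hSΩ)).trans
      (mul_le_mul_right (hint.trans (mul_le_mul_right hSvol _)) _)
  have hR : 0 ≤ Lam * (M ^ q * (|LinearMap.det A| * (2 * 1) ^ n)) := by positivity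
  refine (ENNReal.ofReal_le_ofReal_iff hR).1 ?_
  rw [ENNReal.ofReal_mul hNR.le, ENNReal.ofReal_natCast, ENNReal.ofReal_mul (inv_nonneg.2 hd.le),
    ENNReal.ofReal_pow (by positivity), ENNReal.ofReal_mul hLam, ENNReal.ofReal_mul hMq,
    ENNReal.ofReal_mul hd.le, ENNReal.ofReal_pow (p := (2 * 1 : ℝ)) (by positivity)]
  exact hall
theorem IsNormalized.rpow_mul_sq_le {n : ℕ} (hn : 0 < n) {q lam Lam : ℝ} (hq0 : 0 ≤ q)
    (hlam : 0 < lam) {Ω : Set (Euc n)} {v : Euc n → ℝ} (hv : GenSol n q lam Lam Ω v)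
    {S : Set (Euc n)} {c : Euc n} {A : Euc n →ₗ[ℝ] Euc n} {C : ℝ} (hS : IsNormalized S c A C)
    (hC : 1 ≤ C) (hSΩ : S ⊆ Ω) {θ η : ℝ} (hθ : 0 < θ) (hη : 0 < η) (hθη : θ + 2 * η < 1)
    {P : Euc n} (hP : P ∈ dilate S c θ) (hvP : 0 < v P) {Y : ℝ}
    (hY : ∀ x ∈ dilate S c (θ + 2 * η), v x ≤ Y) :
    v P ^ q * |LinearMap.det A| ^ 2 * (η ^ 2) ^ n ≤ 2 * (C ^ 2 * n) ^ n / lam * Y ^ n := by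
  have h1 := hS.rpow_mul_le hn hq0 hlam hv hC hSΩ hθ hη hθη hP hvP hY
  have hd : 0 < |LinearMap.det A| := abs_pos.2 hS.det_ne
  have hnR : (0 : ℝ) < n := by exact_mod_cast hn
  generalize |LinearMap.det A| = d at *
  have hC0 : 0 < C := by linarith
  have h2 := mul_le_mul_of_nonneg_left h1
    (by positivity : 0 ≤ d * (C * n * η / 2) ^ n / lam)
  calc v P ^ q * d ^ 2 * (η ^ 2) ^ n
      = d * (C * n * η / 2) ^ n / lam * (lam * v P ^ q * (d * (2 * (η / (C * n))) ^ n)) := by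
        have : (C * n * η / 2) ^ n * (2 * (η / (C * n))) ^ n = (η ^ 2) ^ n := by
          rw [← mul_pow]; congr 1; field_simp
        rw [← this]; field_simp
    _ ≤ _ := h2
    _ = 2 * (C ^ 2 * n) ^ n / lam * Y ^ n := by
        have : (C * n * η / 2) ^ n * (2 * (Y * C / η)) ^ n = (C ^ 2 * n) ^ n * Y ^ n := by
          rw [← mul_pow, ← mul_pow]; congr 1; field_simp
        have e : 2 * (C ^ 2 * n) ^ n / lam * Y ^ n = 2 / lam * ((C ^ 2 * n) ^ n * Y ^ n) := by ring
        rw [e, ← this]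
        generalize (C * n * η / 2) ^ n = u
        field_simp

/-- A De Giorgi iteration: if `v` is nonzero somewhere near the centre of `S`, then on a larger
dilate it is comparable to its maximum on `S`. -/
theorem IsNormalized.exists_le_of_pos {n : ℕ} (hn : 0 < n) {q lam Lam : ℝ} (hq0 : 0 ≤ q)
    (hqn : q < n) (hlam : 0 < lam) {C K : ℝ} (hC : 1 ≤ C) (hK : 0 < K) :
    ∃ a : ℝ, 0 < a ∧ ∀ {Ω : Set (Euc n)} {v : Euc n → ℝ}, GenSol n q lam Lam Ω v →
      ∀ {S : Set (Euc n)} {c : Euc n} {A : Euc n →ₗ[ℝ] Euc n}, IsNormalized S c A C →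
      S ⊆ Ω → ∀ {M : ℝ}, 0 < M → M ^ n ≤ K * (M ^ q * |LinearMap.det A| ^ 2) →
      ∀ {z}, z ∈ dilate S c (1 / 4) → 0 < v z → ∃ P ∈ dilate S c (1 / 2), a * M ≤ v P := by
  have hnR : (0 : ℝ) < n := by exact_mod_cast hn
  have hnq : 0 < (n : ℝ) - q := by linarith
  have hC0 : 0 < C := by linarith
  set K₂ : ℝ := 2 * (C ^ 2 * n) ^ n / lam with hK₂
  have hK₂0 : 0 < K₂ := by positivity
  set L := K * K₂ * 256 ^ n with hL
  have hL0 : 0 < L := by positivity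
  set r : ℝ := ((4 : ℝ) ^ n)⁻¹ ^ (((n : ℝ) - q)⁻¹) with hr
  have hr0 : 0 < r := by positivity
  have hr1 : r < 1 := Real.rpow_lt_one (by positivity)
    (inv_lt_one_of_one_lt₀ (one_lt_pow₀ (by norm_num) hn.ne')) (inv_pos.2 hnq)
  have hrp : r ^ ((n : ℝ) - q) = ((4 : ℝ) ^ n)⁻¹ := Real.rpow_inv_rpow (by positivity) hnq.ne'
  set a : ℝ := (r ^ q / (2 * L)) ^ (((n : ℝ) - q)⁻¹) with ha
  have ha0 : 0 < a := by positivity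
  have hap : a ^ ((n : ℝ) - q) = r ^ q / (2 * L) := Real.rpow_inv_rpow (by positivity) hnq.ne'
  refine ⟨a, ha0, fun {Ω v} hv {S c A} hS hSΩ {M} hM hMd {z} hz hvz => ?_⟩
  by_contra! hcon
  have key : ∀ j : ℕ, ∀ x ∈ dilate S c (1 / 4 + (1 / 2) ^ j / 4), v x ≤ M * (a * r ^ j) := by
    intro j
    induction j with
    | zero =>
      intro x hx
      have := hcon x (by convert hx using 2; norm_num)
      rw [pow_zero, mul_one]; linarith [mul_comm a M]
    | succ j ih =>
      intro x hx
      by_contra! hlt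
      set Y := M * (a * r ^ j) with hY
      have hY0 : 0 < Y := by positivity
      have hlt' : Y * r < v x := by
        refine lt_of_eq_of_lt ?_ hlt
        rw [hY, pow_succ]; ring
      have hvx : 0 < v x := lt_trans (by positivity) hlt'
      have hp1 : (1 / 2 : ℝ) ^ j ≤ 1 := pow_le_one₀ (by norm_num) (by norm_num)
      have hθ : 1 / 4 + (1 / 2 : ℝ) ^ (j + 1) / 4 + 2 * ((1 / 2) ^ j / 16) =
          1 / 4 + (1 / 2) ^ j / 4 := by rw [pow_succ]; ring
      have h1 := hS.rpow_mul_sq_le hn hq0 hlam hv hC hSΩ (by positivity)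
        (by positivity : (0 : ℝ) < (1 / 2) ^ j / 16) (by rw [hθ]; linarith) hx hvx
        (Y := Y) (by rw [hθ]; exact ih)
      have h2 : (((1 / 2 : ℝ) ^ j / 16) ^ 2) ^ n = ((4 ^ n)⁻¹ : ℝ) ^ j * (256 ^ n)⁻¹ := by
        have e : ((1 / 2 : ℝ) ^ j / 16) ^ 2 = (1 / 4) ^ j * (1 / 256) := by
          rw [div_pow, ← pow_mul, mul_comm j 2, pow_mul]; norm_num
          ring
        rw [e, mul_pow, ← pow_mul, mul_comm j n, pow_mul, one_div_pow, one_div_pow, one_div, one_div,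
          inv_pow, inv_pow]
      have h3 : (a * r ^ j) ^ n = (a * r ^ j) ^ q * (r ^ q / (2 * L) * ((4 ^ n)⁻¹ : ℝ) ^ j) := by
        have e : (r ^ ((n : ℝ) - q)) ^ j = (r ^ j) ^ ((n : ℝ) - q) := by
          rw [← Real.rpow_natCast (r ^ _), ← Real.rpow_mul hr0.le, mul_comm,
            Real.rpow_mul hr0.le, Real.rpow_natCast]
        rw [← hap, ← hrp, e, ← Real.mul_rpow ha0.le (by positivity),
          ← Real.rpow_add (by positivity), add_sub_cancel, Real.rpow_natCast]
      have h4 : (Y * r) ^ q ≤ v x ^ q := Real.rpow_le_rpow (by positivity) hlt'.le hq0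
      have h5 : (Y * r) ^ q = M ^ q * (a * r ^ j) ^ q * r ^ q := by
        rw [hY, Real.mul_rpow (by positivity) hr0.le, Real.mul_rpow hM.le (by positivity)]
      have hMq : 0 < M ^ q := by positivity
      have hyq : 0 < (a * r ^ j) ^ q := by positivity
      have hrq : 0 < r ^ q := by positivity
      have h4j : (0 : ℝ) < ((4 ^ n)⁻¹ : ℝ) ^ j := by positivity
      have hd : 0 < |LinearMap.det A| := abs_pos.2 hS.det_ne
      rw [h5] at h4
      rw [h2, ← hK₂, hY, mul_pow, h3] at h1
      generalize (a * r ^ j) ^ q = y at *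
      generalize ((4 ^ n)⁻¹ : ℝ) ^ j = w at *
      generalize M ^ q = m at *
      generalize r ^ q = ρ at *
      generalize |LinearMap.det A| = d at *
      have h6 : m * y * ρ * d ^ 2 * (w * (256 ^ n)⁻¹) ≤
          K₂ * (K * (m * d ^ 2) * (y * (ρ / (2 * L) * w))) := by
        calc _ ≤ v x ^ q * d ^ 2 * (w * (256 ^ n)⁻¹) := by gcongr
          _ ≤ _ := h1
          _ ≤ _ := by gcongr
      have h7 : K₂ * (K * (m * d ^ 2) * (y * (ρ / (2 * L) * w))) =
          m * y * ρ * d ^ 2 * (w * (256 ^ n)⁻¹) / 2 := by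
        rw [hL]; field_simp
      have h8 : 0 < m * y * ρ * d ^ 2 * (w * (256 ^ n)⁻¹) := by positivity
      linarith
  have hlim : Filter.Tendsto (fun j : ℕ => M * (a * r ^ j)) Filter.atTop (nhds (M * (a * 0))) :=
    ((tendsto_pow_atTop_nhds_zero_of_lt_one hr0.le hr1).const_mul a).const_mul M
  have hle : v z ≤ M * (a * 0) := ge_of_tendsto' hlim fun j =>
    key j z (hS.dilate_mono (by norm_num) (by
      have : (0 : ℝ) < (1 / 2) ^ j := by positivity
      linarith) hz)
  simp at hle
  linarith

/-- A normalized section on which `v` is not identically zero near the centre cannot reach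
arbitrarily further in one direction than in the opposite one. -/
theorem IsNormalized.exists_card_le {n : ℕ} (hn : 0 < n) {q lam Lam : ℝ} (hq0 : 0 ≤ q)
    (hqn : q < n) (hlam : 0 < lam) (hLam : 0 < Lam) {C D : ℝ} (hC : 1 ≤ C) (hD : 0 < D) :
    ∃ N₀ : ℝ, ∀ {Ω : Set (Euc n)} {v : Euc n → ℝ}, GenSol n q lam Lam Ω v →
      ∀ {S : Set (Euc n)} {c : Euc n} {A : Euc n →ₗ[ℝ] Euc n}, IsNormalized S c A C →
      closure S ⊆ Ω → ∀ {x₁ x₂ p₀ f z : Euc n} {h s : ℝ} {N : ℕ}, x₁ ∈ S → x₂ ∈ S → v x₁ = 0 →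
      0 < h → 0 < s → 0 < N →
      (∀ x ∈ closure S, x ∉ S → ⟪p₀, x - x₁⟫ + h ≤ v x) →
      (∀ x ∈ closure S, ⟪f, x - x₁⟫ ≤ s / (4 * N)) → ⟪f, x₂ - x₁⟫ ≤ -s / 2 →
      (∀ x ∈ S, v x ≤ D * h) → z ∈ dilate S c (1 / 4) → 0 < v z → (N : ℝ) ≤ N₀ := by
  have hnR : (0 : ℝ) < n := by exact_mod_cast hn
  set K : ℝ := Lam * (2 * 1) ^ n * (2 * n * D) ^ n with hK
  have hK0 : 0 < K := by positivity
  obtain ⟨a, ha0, hDG⟩ := IsNormalized.exists_le_of_pos (Lam := Lam) hn hq0 hqn hlam hC hK0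
  refine ⟨K * (64 ^ n * (2 * (C ^ 2 * n) ^ n / lam)) / a ^ q,
    fun {Ω v} hv {S c A} hS hcl {x₁ x₂ p₀ f z h s N} hx₁ hx₂ hv₁ hh hs hN hbd hf hf₂ hM hz hvz => ?_⟩
  have hSΩ : S ⊆ Ω := subset_closure.trans hcl
  have hU := hS.card_mul_le hn hq0 hLam.le hv hcl hx₁ hx₂ hv₁ hh hs hN hbd hf hf₂ hM
  have hd : 0 < |LinearMap.det A| := abs_pos.2 hS.det_ne
  have hM0 : 0 < D * h := by positivity
  have hNR : (1 : ℝ) ≤ N := by exact_mod_cast hN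
  have hU' : N * (D * h) ^ n ≤ K * ((D * h) ^ q * |LinearMap.det A| ^ 2) := by
    have h2 := mul_le_mul_of_nonneg_left hU
      (by positivity : 0 ≤ |LinearMap.det A| * (2 * n * D) ^ n)
    have h3 : (2 * n * D) ^ n * (2 * (h / (4 * n))) ^ n = (D * h) ^ n := by
      rw [← mul_pow]; congr 1; field_simp; norm_num
    calc _ = |LinearMap.det A| * (2 * n * D) ^ n *
          (N * (|LinearMap.det A|⁻¹ * (2 * (h / (4 * n))) ^ n)) := by
          rw [← h3]; field_simp
      _ ≤ _ := h2
      _ = _ := by rw [hK]; ring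
  obtain ⟨P, hP, haP⟩ := hDG hv hS hSΩ hM0
    ((le_mul_of_one_le_left (by positivity) hNR).trans hU') hz hvz
  have hvP : 0 < v P := lt_of_lt_of_le (by positivity) haP
  have hL := hS.rpow_mul_sq_le hn hq0 hlam hv hC hSΩ (by norm_num : (0 : ℝ) < 1 / 2)
    (by norm_num : (0 : ℝ) < 1 / 8) (by norm_num) hP hvP (Y := D * h)
    fun x hx => hM x (hS.dilate_subset (by norm_num) (by norm_num) hx)
  have h1 : a ^ q * (D * h) ^ q ≤ v P ^ q := by
    rw [← Real.mul_rpow ha0.le hM0.le]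
    exact Real.rpow_le_rpow (by positivity) haP hq0
  have haq : 0 < a ^ q := by positivity
  have hmq : 0 < (D * h) ^ q := by positivity
  have hmn : 0 < (D * h) ^ n := by positivity
  have h64 : ((1 / 8 : ℝ) ^ 2) ^ n = (64 ^ n)⁻¹ := by
    rw [← inv_pow]; norm_num
  rw [h64] at hL
  rw [le_div_iff₀ haq]
  refine le_of_mul_le_mul_right ?_ hmn
  generalize (D * h) ^ q = m at *
  generalize (D * h) ^ n = e at *
  generalize |LinearMap.det A| = d at *
  generalize 2 * (C ^ 2 * n) ^ n / lam = K₂ at *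
  generalize a ^ q = b at *
  have h2 : b * m * d ^ 2 * (64 ^ n)⁻¹ ≤ K₂ * e :=
    le_trans (by gcongr) hL
  have h3 : b * m * d ^ 2 ≤ 64 ^ n * (K₂ * e) := by
    have := mul_le_mul_of_nonneg_left h2 (by positivity : (0 : ℝ) ≤ 64 ^ n)
    calc _ = (64 : ℝ) ^ n * (b * m * d ^ 2 * (64 ^ n)⁻¹) := by field_simp
      _ ≤ _ := this
  calc N * b * e = b * (N * e) := by ring
    _ ≤ b * (K * (m * d ^ 2)) := by gcongr
    _ = K * (b * m * d ^ 2) := by ring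
    _ ≤ K * (64 ^ n * (K₂ * e)) := by gcongr
    _ = _ := by ring
/-- The section of `v` over `B` cut by the affine function of slope `p` and value `h` at `x₁`. -/
def sect {n : ℕ} (B : Set (Euc n)) (v : Euc n → ℝ) (x₁ p : Euc n) (h : ℝ) : Set (Euc n) :=
  {x ∈ B | v x < ⟪p, x - x₁⟫ + h}

theorem isOpen_sect {n : ℕ} {B : Set (Euc n)} {v : Euc n → ℝ} (hB : IsOpen B)
    (hcont : ContinuousOn v B) (x₁ p : Euc n) (h : ℝ) : IsOpen (sect B v x₁ p h) := by
  have : IsOpen (B ∩ (fun x => v x - (⟪p, x - x₁⟫ + h)) ⁻¹' Iio 0) :=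
    (hcont.sub (Continuous.continuousOn (by fun_prop))).isOpen_inter_preimage hB isOpen_Iio
  convert this using 1
  ext x
  simp [sect, sub_neg]

theorem convexOn_sub_affine {n : ℕ} {B : Set (Euc n)} {v : Euc n → ℝ} (hconv : ConvexOn ℝ B v)
    (x₁ p : Euc n) (h : ℝ) : ConvexOn ℝ B fun x => v x - (⟪p, x - x₁⟫ + h) := by
  have h1 : ConcaveOn ℝ B fun x => ⟪p, x - x₁⟫ + h := by
    have := ((innerₛₗ ℝ p).concaveOn hconv.1).add (concaveOn_const (h - ⟪p, x₁⟫) hconv.1)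
    refine this.congr fun x _ => ?_
    simp [inner_sub_right]; ring
  exact hconv.sub h1

theorem convex_sect {n : ℕ} {B : Set (Euc n)} {v : Euc n → ℝ} (hconv : ConvexOn ℝ B v)
    (x₁ p : Euc n) (h : ℝ) : Convex ℝ (sect B v x₁ p h) := by
  have := (convexOn_sub_affine hconv x₁ p h).convex_lt 0
  simp only [sub_neg] at this
  exact this

/-- The boundary of a section with nonempty interior is a null set. -/
theorem volume_eq_affine {n : ℕ} {B : Set (Euc n)} {v : Euc n → ℝ} (hB : IsOpen B)
    (hcont : ContinuousOn v B) (hconv : ConvexOn ℝ B v) {x₁ p : Euc n} {h : ℝ} (hx₁ : x₁ ∈ B)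
    (hv₁ : v x₁ < h) : volume {x ∈ B | v x = ⟪p, x - x₁⟫ + h} = 0 := by
  refine measure_mono_null ?_ ((convex_sect hconv x₁ p h).addHaar_frontier volume)
  rintro x ⟨hx, hxe⟩
  rw [(isOpen_sect hB hcont x₁ p h).frontier_eq]
  refine ⟨?_, fun hxs => hxs.2.ne hxe⟩
  refine closure_mono ?_ (segment_subset_closure_openSegment (𝕜 := ℝ) (right_mem_segment ℝ x₁ x))
  rintro _ ⟨a, b, ha, hb, hab, rfl⟩
  refine ⟨hconv.1 hx₁ hx ha.le hb.le hab, ?_⟩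
  have h1 := (convexOn_sub_affine hconv x₁ p h).2 hx₁ hx ha.le hb.le hab
  simp only [hxe, sub_self, inner_zero_right, zero_add, smul_eq_mul, mul_zero, add_zero] at h1
  nlinarith

/-- Tilting a section in the direction `g` one can make its barycentre lie on the side where
`g` is nonnegative, and on the hyperplane itself if the tilt is nontrivial. -/
theorem exists_tilt {n : ℕ} {B : Set (Euc n)} {v : Euc n → ℝ} (hB : IsOpen B)
    (hBb : Bornology.IsBounded B) (hcont : ContinuousOn v B) (hconv : ConvexOn ℝ B v)
    {x₁ p g : Euc n} {h : ℝ} (hx₁ : x₁ ∈ B) (hv₁ : v x₁ < h) (hg : g ≠ 0) :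
    ∃ b : ℝ, 0 ≤ b ∧ 0 ≤ ∫ x in sect B v x₁ (p + b • g) h, ⟪g, x - x₁⟫ ∧
      b * ∫ x in sect B v x₁ (p + b • g) h, ⟪g, x - x₁⟫ = 0 := by
  set F : ℝ → Euc n → ℝ := fun b => (sect B v x₁ (p + b • g) h).indicator fun x => ⟪g, x - x₁⟫
    with hF
  have hSm : ∀ b : ℝ, MeasurableSet (sect B v x₁ (p + b • g) h) := fun b =>
    (isOpen_sect hB hcont _ _ _).measurableSet
  have hFi : ∀ b, ∫ x in sect B v x₁ (p + b • g) h, ⟪g, x - x₁⟫ = ∫ x, F b x := fun b =>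
    (integral_indicator (hSm b)).symm
  have hmeas : ∀ b, AEStronglyMeasurable (F b) volume := fun b =>
    (Continuous.aestronglyMeasurable (by fun_prop)).indicator (hSm b)
  set bound : Euc n → ℝ := B.indicator fun x => ‖⟪g, x - x₁⟫‖ with hbound
  have hboundi : Integrable bound volume :=
    (continuousOn_integrableOn_of_isBounded hBb (by fun_prop)).integrable_indicator hB.measurableSet
  have hle : ∀ b x, ‖F b x‖ ≤ bound x := fun b x => by
    by_cases hx : x ∈ sect B v x₁ (p + b • g) h
    · simp only [hF, hbound, indicator_of_mem hx, indicator_of_mem hx.1, le_refl]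
    · simp only [hF, indicator_of_notMem hx, norm_zero]
      exact indicator_nonneg (fun _ _ => norm_nonneg _) x
  have hcontF : Continuous fun b => ∫ x, F b x := by
    refine continuous_iff_continuousAt.2 fun b => ?_
    refine continuousAt_of_dominated (.of_forall hmeas) (.of_forall fun b => .of_forall (hle b))
      hboundi ?_
    have hnull := volume_eq_affine hB hcont hconv (p := p + b • g) hx₁ hv₁
    filter_upwards [measure_eq_zero_iff_ae_notMem.1 hnull] with x hx
    have hline : Continuous fun b' : ℝ => ⟪p + b' • g, x - x₁⟫ + h := by fun_prop
    by_cases hxB : x ∈ B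
    · rcases lt_or_gt_of_ne (fun he => hx ⟨hxB, he⟩ : v x ≠ ⟪p + b • g, x - x₁⟫ + h) with h1 | h1
      · have : ∀ᶠ b' in nhds b, F b' x = ⟪g, x - x₁⟫ := by
          filter_upwards [hline.continuousAt.eventually (lt_mem_nhds h1)] with b' hb'
          exact indicator_of_mem (show x ∈ sect B v x₁ (p + b' • g) h from ⟨hxB, hb'⟩) _
        exact continuousAt_const.congr (this.mono fun _ h => h.symm)
      · have : ∀ᶠ b' in nhds b, F b' x = 0 := by
          filter_upwards [hline.continuousAt.eventually (gt_mem_nhds h1)] with b' hb'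
          exact indicator_of_notMem (fun hm => hb'.not_gt hm.2) _
        exact continuousAt_const.congr (this.mono fun _ h => h.symm)
    · have : ∀ b', F b' x = 0 := fun b' => indicator_of_notMem (fun hm => hxB hm.1) _
      simp only [this]
      exact continuousAt_const
  rcases le_or_gt 0 (∫ x, F 0 x) with h0 | h0
  · exact ⟨0, le_rfl, by rw [hFi]; exact h0, by simp⟩
  set G : Euc n → ℝ := B.indicator fun x => max ⟪g, x - x₁⟫ 0 with hG
  have hlim : Filter.Tendsto (fun b => ∫ x, F b x) Filter.atTop (nhds (∫ x, G x)) := by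
    refine tendsto_integral_filter_of_dominated_convergence bound (.of_forall hmeas)
      (.of_forall fun b => .of_forall (hle b)) hboundi (.of_forall fun x => ?_)
    refine tendsto_const_nhds.congr' ?_
    by_cases hxB : x ∈ B
    · simp only [hF, hG, indicator_of_mem hxB]
      have hexp : ∀ b : ℝ, ⟪p + b • g, x - x₁⟫ = ⟪p, x - x₁⟫ + b * ⟪g, x - x₁⟫ := fun b => by
        rw [inner_add_left, real_inner_smul_left]
      rcases lt_trichotomy ⟪g, x - x₁⟫ 0 with h1 | h1 | h1
      · filter_upwards [Filter.eventually_ge_atTop ((v x - ⟪p, x - x₁⟫ - h) / ⟪g, x - x₁⟫)]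
          with b hb
        rw [indicator_of_notMem, max_eq_right h1.le]
        rintro ⟨-, hm⟩
        rw [hexp] at hm
        rw [div_le_iff_of_neg h1] at hb
        linarith
      · refine .of_forall fun b => ?_
        change max ⟪g, x - x₁⟫ 0 = indicator _ (fun x => ⟪g, x - x₁⟫) x
        rw [h1, max_self]
        by_cases hm : x ∈ sect B v x₁ (p + b • g) h
        · rw [indicator_of_mem hm, h1]
        · rw [indicator_of_notMem hm]
      · filter_upwards [Filter.eventually_gt_atTop ((v x - ⟪p, x - x₁⟫ - h) / ⟪g, x - x₁⟫)]
          with b hb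
        rw [indicator_of_mem, max_eq_left h1.le]
        refine ⟨hxB, ?_⟩
        rw [hexp]
        rw [div_lt_iff₀ h1] at hb
        linarith
    · refine .of_forall fun b => ?_
      simp only [hF, hG]
      rw [indicator_of_notMem hxB, indicator_of_notMem fun hm => hxB hm.1]
  have hGpos : 0 < ∫ x, G x := by
    rw [hG, integral_indicator hB.measurableSet, setIntegral_pos_iff_support_of_nonneg_ae
      (f := fun x => max ⟪g, x - x₁⟫ 0) (.of_forall fun x => le_max_right _ _)
      (continuousOn_integrableOn_of_isBounded hBb (by fun_prop))]
    have hopen : IsOpen ({x | 0 < ⟪g, x - x₁⟫} ∩ B) :=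
      (isOpen_lt continuous_const (by fun_prop)).inter hB
    obtain ⟨κ, hκ0, hκ⟩ : ∃ κ : ℝ, 0 < κ ∧ x₁ + κ • g ∈ B := by
      have hc : Continuous fun κ : ℝ => x₁ + κ • g := by fun_prop
      have h1 : ∀ᶠ κ in nhdsWithin (0 : ℝ) (Ioi 0), x₁ + κ • g ∈ B :=
        (hc.tendsto 0).eventually (by simpa using hB.mem_nhds hx₁) |>.filter_mono nhdsWithin_le_nhds
      obtain ⟨κ, h2, h3⟩ := (h1.and self_mem_nhdsWithin).exists
      exact ⟨κ, h3, h2⟩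
    refine (hopen.measure_pos volume ⟨x₁ + κ • g, ?_, hκ⟩).trans_le
      (measure_mono (inter_subset_inter_left _ fun x hx => ?_))
    · have : 0 < ‖g‖ := norm_pos_iff.2 hg
      simp only [mem_ofPred_eq, add_sub_cancel_left, inner_smul_right, real_inner_self_eq_norm_sq]
      positivity
    · have hx' : 0 < ⟪g, x - x₁⟫ := hx
      simp [max_eq_left hx'.le, hx'.ne']
  obtain ⟨b₁, hb₁, hb₁0⟩ := ((hlim.eventually (lt_mem_nhds hGpos)).and
    (Filter.eventually_ge_atTop 0)).exists
  obtain ⟨b, hb, hb0⟩ := intermediate_value_Icc hb₁0 hcontF.continuousOn ⟨h0.le, hb₁.le⟩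
  simp only at hb0
  exact ⟨b, hb.1, by rw [hFi, hb0], by rw [hFi, hb0, mul_zero]⟩

theorem exists_barycentre {n : ℕ} {S : Set (Euc n)} (hSo : IsOpen S)
    (hSb : Bornology.IsBounded S) (hne : S.Nonempty) :
    ∃ c : Euc n, ∀ f : Euc n, ∫ x in S, ⟪f, x - c⟫ = 0 := by
  have hvol : volume.real S ≠ 0 :=
    (ENNReal.toReal_pos (hSo.measure_pos volume hne).ne' hSb.measure_lt_top.ne).ne'
  have hi : IntegrableOn (fun x : Euc n => x) S :=
    (continuousOn_id.integrableOn_compact hSb.isCompact_closure).mono_set subset_closure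
  refine ⟨(volume.real S)⁻¹ • ∫ x in S, x, fun f => ?_⟩
  have hconst : IntegrableOn (fun _ : Euc n => (volume.real S)⁻¹ • ∫ x in S, x) S :=
    integrableOn_const hSb.measure_lt_top.ne
  have hi' : IntegrableOn (fun y : Euc n => y - (volume.real S)⁻¹ • ∫ x in S, x) S :=
    hi.sub hconst
  rw [integral_inner hi', integral_sub hi hconst, setIntegral_const,
    smul_inv_smul₀ hvol, sub_self, inner_zero_right]

theorem integral_inner_sub {n : ℕ} {S : Set (Euc n)} (hSb : Bornology.IsBounded S) {c : Euc n}
    (hc : ∀ f : Euc n, ∫ x in S, ⟪f, x - c⟫ = 0) (g x₁ : Euc n) :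
    ∫ x in S, ⟪g, x - x₁⟫ = volume.real S * ⟪g, c - x₁⟫ := by
  have h1 : (fun x => ⟪g, x - x₁⟫) = fun x => ⟪g, x - c⟫ + ⟪g, c - x₁⟫ := funext fun x => by
    rw [← inner_add_right, sub_add_sub_cancel]
  rw [h1, integral_add (continuousOn_integrableOn_of_isBounded hSb (by fun_prop))
    (continuousOn_integrableOn_of_isBounded hSb (by fun_prop)), hc g, setIntegral_const,
    smul_eq_mul, zero_add]
/-- If every sufficiently low point of a ball lies, up to a small error, on one side of `x₁` in the
direction `f` while the coincidence set reaches a fixed distance to the other side, then the error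
is bounded below. -/
theorem exists_forall_le {n : ℕ} (hn : 0 < n) {q lam Lam : ℝ} (hq0 : 0 ≤ q)
    (hqn : q < n) (hlam : 0 < lam) (hLam : 0 < Lam) :
    ∃ N₀ : ℝ, ∀ {Ω : Set (Euc n)} {v : Euc n → ℝ}, GenSol n q lam Lam Ω v →
      ∀ {x₀ : Euc n} {r : ℝ}, closedBall x₀ r ⊆ Ω →
      ∀ {x₁ x₂ f g : Euc n} {s η : ℝ} {N : ℕ}, x₁ ∈ ball x₀ r → v x₁ = 0 → x₂ ∈ ball x₀ r →
      v x₂ = 0 → g ≠ 0 → (∀ x ∈ coin Ω v, ⟪g, x - x₁⟫ ≤ 0) → 0 < s → 0 < η → 0 < N →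
      (∀ x ∈ closedBall x₀ r, v x ≤ η → ⟪f, x - x₁⟫ ≤ s / (4 * N)) →
      (∀ x ∈ sphere x₀ r, v x ≤ η → ⟪f, x - x₁⟫ < -(2 * 2 ^ (n + 1) + 1) * s) →
      ⟪f, x₂ - x₁⟫ = -s / 2 → ⟪g, x₂ - x₁⟫ = 0 → (N : ℝ) ≤ N₀ := by
  set C : ℝ := 2 ^ (n + 1) with hCdef
  have hC : 1 ≤ C := one_le_pow₀ (by norm_num)
  have hC0 : 0 < C := by linarith
  obtain ⟨N₀, hN₀⟩ := IsNormalized.exists_card_le hn hq0 hqn hlam hLam hC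
    (by positivity : 0 < 2 * (C + 1))
  refine ⟨N₀, fun {Ω v} hv {x₀ r} hrΩ {x₁ x₂ f g s η N} hx₁ hv₁ hx₂ hv₂ hg hgK hs hη hN hlow hsph
    hf₂ hg₂ => ?_⟩
  have hNR : (1 : ℝ) ≤ N := by exact_mod_cast hN
  have hballΩ : ball x₀ r ⊆ Ω := ball_subset_closedBall.trans hrΩ
  have hcont : ContinuousOn v Ω := hv.1
  have hnn : ∀ x ∈ Ω, 0 ≤ v x := hv.2.2.1
  have hcontB : ContinuousOn v (ball x₀ r) := hcont.mono hballΩ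
  have hconvB : ConvexOn ℝ (ball x₀ r) v := hv.2.1.subset hballΩ (convex_ball x₀ r)
  obtain ⟨R, hR0, hR⟩ : ∃ R : ℝ, 0 ≤ R ∧ ∀ x ∈ ball x₀ r, ⟪f, x - x₁⟫ ≤ R := by
    obtain ⟨R, hR⟩ := (isCompact_closedBall x₀ r).exists_bound_of_continuousOn
      (f := fun x => ⟪f, x - x₁⟫) (Continuous.continuousOn (by fun_prop))
    have h1 : ∀ x ∈ ball x₀ r, ⟪f, x - x₁⟫ ≤ R := fun x hx =>
      (le_abs_self _).trans (hR x (ball_subset_closedBall hx))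
    exact ⟨R, by simpa using h1 x₁ hx₁, h1⟩
  set ε : ℝ := η / ((C + 1) * (R + s)) with hε
  have hε0 : 0 < ε := by positivity
  have hεη : (C + 1) * (ε * (R + s)) = η := by rw [hε]; field_simp
  obtain ⟨b, hb0, hbI, hbI0⟩ := exists_tilt isOpen_ball isBounded_ball hcontB hconvB
    (p := ε • f) (h := ε * s) hx₁ (by rw [hv₁]; positivity) hg
  set S := sect (ball x₀ r) v x₁ (ε • f + b • g) (ε * s) with hSdef
  have hSo : IsOpen S := isOpen_sect isOpen_ball hcontB _ _ _
  have hSc : Convex ℝ S := convex_sect hconvB _ _ _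
  have hSball : S ⊆ ball x₀ r := fun x hx => hx.1
  have hSb : Bornology.IsBounded S := isBounded_ball.subset hSball
  have hx₁S : x₁ ∈ S := ⟨hx₁, by simp [hv₁]; positivity⟩
  obtain ⟨c, hc⟩ := exists_barycentre hSo hSb ⟨x₁, hx₁S⟩
  obtain ⟨A, hS⟩ := exists_isNormalized hSo hSc hSb ⟨x₁, hx₁S⟩ hc
  have hvol : 0 < volume.real S :=
    ENNReal.toReal_pos (hSo.measure_pos volume ⟨x₁, hx₁S⟩).ne' hSb.measure_lt_top.ne
  rw [integral_inner_sub hSb hc] at hbI hbI0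
  have hγc : 0 ≤ ⟪g, c - x₁⟫ := nonneg_of_mul_nonneg_right hbI hvol
  have hbγc : b * ⟪g, c - x₁⟫ = 0 := by
    have : volume.real S * (b * ⟪g, c - x₁⟫) = 0 := by linarith
    exact (mul_eq_zero.1 this).resolve_left hvol.ne'
  have hexp : ∀ x, ⟪ε • f + b • g, x - x₁⟫ + ε * s =
      ε * (⟪f, x - x₁⟫ + s) + b * ⟪g, x - x₁⟫ := fun x => by
    rw [inner_add_left, real_inner_smul_left, real_inner_smul_left]; ring
  have hpos : ∀ x ∈ S, v x < ε * (⟪f, x - x₁⟫ + s) + b * ⟪g, x - x₁⟫ ∧ 0 ≤ v x := fun x hx =>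
    ⟨by rw [← hexp]; exact hx.2, hnn x (hballΩ hx.1)⟩
  have hopp : ∀ (w x : Euc n), ⟪w, c - C⁻¹ • (x - c) - x₁⟫ =
      ⟪w, c - x₁⟫ - C⁻¹ * (⟪w, x - x₁⟫ - ⟪w, c - x₁⟫) := fun w x => by
    rw [← inner_sub_right, ← inner_smul_right, ← inner_sub_right]
    congr 1
    module
  have hmax : ∀ x ∈ S, ε * (⟪f, x - x₁⟫ + s) + b * ⟪g, x - x₁⟫ ≤
      (C + 1) * (ε * (⟪f, c - x₁⟫ + s)) := fun x hx => by
    have h1 := hpos _ (barycentre_balanced hSo hSc hSb hc hx)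
    rw [← hCdef, hopp, hopp] at h1
    have h2 := h1.2.trans_lt h1.1
    have h3 : C * (ε * (⟪f, c - x₁⟫ - C⁻¹ * (⟪f, x - x₁⟫ - ⟪f, c - x₁⟫) + s) +
        b * (⟪g, c - x₁⟫ - C⁻¹ * (⟪g, x - x₁⟫ - ⟪g, c - x₁⟫))) =
        (C + 1) * (ε * (⟪f, c - x₁⟫ + s)) - (ε * (⟪f, x - x₁⟫ + s) + b * ⟪g, x - x₁⟫) +
          (C + 1) * (b * ⟪g, c - x₁⟫) := by
      field_simp; ring
    have h4 := mul_pos hC0 h2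
    rw [h3, hbγc] at h4
    linarith
  have hcB := hSball hS.mem
  have hvη : ∀ x ∈ S, v x ≤ η := fun x hx => by
    have h1 := hpos x hx
    have h2 := hmax x hx
    have h3 : (C + 1) * (ε * (⟪f, c - x₁⟫ + s)) ≤ η := by
      rw [← hεη]; gcongr; exact hR c hcB
    linarith
  have hclB : closure S ⊆ closedBall x₀ r :=
    (closure_mono hSball).trans closure_ball_subset_closedBall
  have hvηcl : ∀ x ∈ closure S, v x ≤ η := fun x hx =>
    ContinuousWithinAt.closure_le hx
      ((hcont x (hrΩ (hclB hx))).mono (hSball.trans hballΩ)) continuousWithinAt_const hvη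
  have hφup : ∀ x ∈ closure S, ⟪f, x - x₁⟫ ≤ s / (4 * N) := fun x hx =>
    hlow x (hclB hx) (hvηcl x hx)
  have hs4 : s / (4 * N) ≤ s := div_le_self hs.le (by linarith)
  have hφs : ∀ x ∈ S, ⟪f, x - x₁⟫ ≤ s := fun x hx => (hφup x (subset_closure hx)).trans hs4
  have hM : ∀ x ∈ S, v x ≤ 2 * (C + 1) * (ε * s) := fun x hx => by
    have h1 := hpos x hx
    have h2 := hmax x hx
    have h3 : (C + 1) * (ε * (⟪f, c - x₁⟫ + s)) ≤ (C + 1) * (ε * (s + s)) := by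
      gcongr; exact hφs c hS.mem
    linarith
  have hφlow : ∀ x ∈ S, -(2 * C + 1) * s ≤ ⟪f, x - x₁⟫ := fun x hx => by
    have h1 := hpos x hx
    have hy := barycentre_balanced hSo hSc hSb hc hx
    have h2 := hpos _ hy
    have h3 := hφs _ hy
    rw [← hCdef] at h2 h3
    have h4 : b * ⟪g, c - C⁻¹ • (x - c) - x₁⟫ = -(C⁻¹ * (b * ⟪g, x - x₁⟫)) := by
      rw [hopp]; linear_combination (1 + C⁻¹) * hbγc
    rw [h4] at h2
    have h5 : C⁻¹ * (b * ⟪g, x - x₁⟫) ≤ ε * (s + s) := by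
      have : ε * (⟪f, c - C⁻¹ • (x - c) - x₁⟫ + s) ≤ ε * (s + s) := by gcongr
      linarith
    have h6 : b * ⟪g, x - x₁⟫ ≤ C * (ε * (s + s)) := by
      rwa [inv_mul_le_iff₀ hC0] at h5
    have h7 : 0 < ε * (⟪f, x - x₁⟫ + s + 2 * C * s) := by linarith
    have h8 := pos_of_mul_pos_right h7 hε0.le
    linarith
  have hφlowcl : ∀ x ∈ closure S, -(2 * C + 1) * s ≤ ⟪f, x - x₁⟫ := fun x hx =>
    closure_minimal (t := {x : Euc n | -(2 * C + 1) * s ≤ ⟪f, x - x₁⟫}) hφlow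
      (isClosed_le continuous_const (by fun_prop)) hx
  have hclball : closure S ⊆ ball x₀ r := fun x hx => by
    by_contra hxb
    have hxs : x ∈ sphere x₀ r := by
      have h1 := hclB hx
      rw [mem_closedBall] at h1
      rw [mem_ball, not_lt] at hxb
      exact le_antisymm h1 hxb
    exact (hsph x hxs (hvηcl x hx)).not_ge (hφlowcl x hx)
  have hx₂S : x₂ ∈ S := by
    refine ⟨hx₂, ?_⟩
    rw [hexp, hf₂, hg₂, hv₂]
    have : 0 < ε * s := by positivity
    linarith
  have hgn : 0 < ‖g‖ := norm_pos_iff.2 hg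
  obtain ⟨κ, hκ0, hκ⟩ : ∃ κ : ℝ, 0 < κ ∧ c + κ • g ∈ S := by
    have hcc : Continuous fun κ : ℝ => c + κ • g := by fun_prop
    have h1 : ∀ᶠ κ in nhdsWithin (0 : ℝ) (Ioi 0), c + κ • g ∈ S :=
      ((hcc.tendsto 0).eventually (by simpa using hSo.mem_nhds hS.mem)).filter_mono
        nhdsWithin_le_nhds
    obtain ⟨κ, h2, h3⟩ := (h1.and self_mem_nhdsWithin).exists
    exact ⟨κ, h3, h2⟩
  have hz : c + (1 / 4 : ℝ) • (κ • g) ∈ dilate S c (1 / 4) :=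
    ⟨c + κ • g, subset_closure hκ, by simp⟩
  have hzΩ := hballΩ (hSball (hS.dilate_subset (by norm_num) (by norm_num) hz))
  have hvz : 0 < v (c + (1 / 4 : ℝ) • (κ • g)) := by
    refine (hnn _ hzΩ).lt_of_ne' fun h0 => ?_
    have h1 := hgK _ ⟨hzΩ, h0⟩
    have h2 : ⟪g, c + (1 / 4 : ℝ) • (κ • g) - x₁⟫ = ⟪g, c - x₁⟫ + 1 / 4 * (κ * ‖g‖ ^ 2) := by
      rw [add_sub_right_comm, inner_add_right, inner_smul_right, inner_smul_right,
        real_inner_self_eq_norm_sq]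
    have h3 : 0 < κ * ‖g‖ ^ 2 := by positivity
    linarith
  exact hN₀ hv hS (hclball.trans hballΩ) hx₁S hx₂S hv₁ (by positivity) hs hN
    (fun x hx hxS => not_lt.1 fun hlt => hxS ⟨hclball hx, hlt⟩) hφup hf₂.le hM hz hvz

/-- A compact subset of a compact convex set which misses a given extreme point can be enlarged to
a compact convex subset which still misses that point. -/
theorem exists_compact_convex_of_extremePoint {E : Type*} [NormedAddCommGroup E]
    [NormedSpace ℝ E] {D T : Set E} (hD : IsCompact D) (hDc : Convex ℝ D) (hT : IsCompact T)
    (hTD : T ⊆ D) {x : E} (hx : x ∈ Set.extremePoints ℝ D) (hxT : x ∉ T) :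
    ∃ C, IsCompact C ∧ Convex ℝ C ∧ T ⊆ C ∧ C ⊆ D ∧ x ∉ C := by
  refine hT.induction_on
    (p := fun S => ∃ C, IsCompact C ∧ Convex ℝ C ∧ S ⊆ C ∧ C ⊆ D ∧ x ∉ C) ?_ ?_ ?_ ?_
  · exact ⟨∅, isCompact_empty, convex_empty, subset_rfl, empty_subset _, notMem_empty _⟩
  · rintro S S' h ⟨C, h1, h2, h3, h4⟩
    exact ⟨C, h1, h2, h.trans h3, h4⟩
  · rintro S S' ⟨C, h1, h2, h3, h4, h5⟩ ⟨C', h1', h2', h3', h4', h5'⟩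
    rcases C.eq_empty_or_nonempty with rfl | hne
    · exact ⟨C', h1', h2', union_subset (h3.trans (empty_subset _)) h3', h4', h5'⟩
    rcases C'.eq_empty_or_nonempty with rfl | hne'
    · exact ⟨C, h1, h2, union_subset h3 (h3'.trans (empty_subset _)), h4, h5⟩
    refine ⟨convexJoin ℝ C C', ?_, h2.convexJoin h2',
      union_subset (h3.trans (subset_convexJoin_left hne'))
        (h3'.trans (subset_convexJoin_right hne)), ?_, ?_⟩
    · have : convexJoin ℝ C C' = (fun p : ℝ × E × E => (1 - p.1) • p.2.1 + p.1 • p.2.2) ''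
          (Icc 0 1 ×ˢ C ×ˢ C') := by
        ext z
        simp only [mem_convexJoin, segment_eq_image, mem_image, Prod.exists, mem_prod]
        constructor
        · rintro ⟨a, ha, b, hb, t, ht, rfl⟩
          exact ⟨t, a, b, ⟨ht, ha, hb⟩, rfl⟩
        · rintro ⟨t, a, b, ⟨ht, ha, hb⟩, rfl⟩
          exact ⟨a, ha, b, hb, t, ht, rfl⟩
      rw [this]
      exact (isCompact_Icc.prod (h1.prod h1')).image (by fun_prop)
    · exact convexJoin_subset h4 h4' hDc
    · intro hxm
      obtain ⟨a, ha, b, hb, hxab⟩ := mem_convexJoin.1 hxm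
      rcases (mem_extremePoints_iff_forall_segment.1 hx).2 a (h4 ha) b (h4' hb) hxab with rfl | rfl
      · exact h5 ha
      · exact h5' hb
  · intro y hy
    have hd : 0 < dist x y := dist_pos.2 (fun h => hxT (h ▸ hy))
    refine ⟨T ∩ closedBall y (dist x y / 2), inter_mem_nhdsWithin _
      (closedBall_mem_nhds _ (by positivity)), D ∩ closedBall y (dist x y / 2),
      hD.inter_right isClosed_closedBall, hDc.inter (convex_closedBall _ _),
      inter_subset_inter_left _ hTD, inter_subset_left, fun h => ?_⟩
    have := mem_closedBall.1 h.2
    linarith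

/-- A continuous function which is negative on the zero set of a nonnegative function is negative
on a sublevel set. -/
theorem exists_pos_forall_le_imp_neg {X : Type*} [TopologicalSpace X] [T2Space X] {S : Set X}
    (hS : IsCompact S) {φ ψ : X → ℝ} (hφ : ContinuousOn φ S) (hψ : ContinuousOn ψ S)
    (hψ0 : ∀ x ∈ S, 0 ≤ ψ x) (h : ∀ x ∈ S, ψ x = 0 → φ x < 0) :
    ∃ η > 0, ∀ x ∈ S, ψ x ≤ η → φ x < 0 := by
  have hS' : IsCompact (S ∩ φ ⁻¹' Ici 0) :=
    hS.of_isClosed_subset (hφ.preimage_isClosed_of_isClosed hS.isClosed isClosed_Ici)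
      inter_subset_left
  rcases (S ∩ φ ⁻¹' Ici 0).eq_empty_or_nonempty with he | hne
  · refine ⟨1, one_pos, fun x hx _ => ?_⟩
    by_contra! hcon
    exact notMem_empty x (he ▸ ⟨hx, hcon⟩)
  · obtain ⟨z, hz, hmin⟩ := hS'.exists_isMinOn hne (hψ.mono inter_subset_left)
    have hpos : 0 < ψ z := (hψ0 z hz.1).lt_of_ne fun h0 => (h z hz.1 h0.symm).not_ge hz.2
    refine ⟨ψ z / 2, by positivity, fun x hx hle => ?_⟩
    by_contra! hcon
    have := hmin (show x ∈ S ∩ φ ⁻¹' Ici 0 from ⟨hx, hcon⟩)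
    simp only [mem_ofPred_eq] at this
    linarith

/-- A continuous function which is negative on the zero set of a nonnegative function becomes
negative after subtracting a large multiple of the latter. -/
theorem exists_forall_sub_mul_neg {X : Type*} [TopologicalSpace X] [T2Space X] {S : Set X}
    (hS : IsCompact S) {φ ψ : X → ℝ} (hφ : ContinuousOn φ S) (hψ : ContinuousOn ψ S)
    (hψ0 : ∀ x ∈ S, 0 ≤ ψ x) (h : ∀ x ∈ S, ψ x = 0 → φ x < 0) :
    ∃ B, ∀ b, B ≤ b → ∀ x ∈ S, φ x - b * ψ x < 0 := by
  obtain ⟨η, hη, hlt⟩ := exists_pos_forall_le_imp_neg hS hφ hψ hψ0 h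
  obtain ⟨M, hM⟩ := (hS.image_of_continuousOn hφ).bddAbove
  refine ⟨(|M| + 1) / η, fun b hb x hx => ?_⟩
  have hb0 : 0 ≤ b := le_trans (by positivity) hb
  have h0 := hψ0 x hx
  rcases le_or_gt (ψ x) η with hle | hgt
  · nlinarith [hlt x hx hle, mul_nonneg hb0 h0]
  · have h1 : φ x ≤ M := hM (mem_image_of_mem _ hx)
    have h2 : |M| + 1 ≤ b * η := (div_le_iff₀ hη).1 hb
    nlinarith [le_abs_self M, mul_le_mul_of_nonneg_left hgt.le hb0]

/-- A convex set has a nonzero supporting vector at each of its boundary points. -/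
theorem exists_supporting {n : ℕ} {K : Set (Euc n)} (hK : Convex ℝ K) {z : Euc n} (hz : z ∈ K)
    (hzi : z ∉ interior K) : ∃ g : Euc n, g ≠ 0 ∧ ∀ x ∈ K, ⟪g, x⟫ ≤ ⟪g, z⟫ := by
  by_cases hi : (interior K).Nonempty
  · obtain ⟨f, hf, hle⟩ := geometric_hahn_banach_of_nonempty_interior_point hK hzi hi
    refine ⟨(InnerProductSpace.toDual ℝ (Euc n)).symm f, by simpa using hf, fun x hx => ?_⟩
    simpa [InnerProductSpace.toDual_symm_apply] using hle x hx
  · have h1 : affineSpan ℝ K ≠ ⊤ := fun h => hi (hK.interior_nonempty_iff_affineSpan_eq_top.2 h)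
    have h2 : (affineSpan ℝ K).direction ≠ ⊤ := fun h =>
      h1 ((AffineSubspace.direction_eq_top_iff_of_nonempty
        ⟨z, subset_affineSpan ℝ K hz⟩).1 h)
    have h3 : (affineSpan ℝ K).directionᗮ ≠ ⊥ := fun h =>
      h2 ((Submodule.orthogonal_eq_bot_iff).1 h)
    obtain ⟨g, hg, hg0⟩ := Submodule.exists_mem_ne_zero_of_ne_bot h3
    refine ⟨g, hg0, fun x hx => ?_⟩
    have := (Submodule.mem_orthogonal' _ _).1 hg (x - z)
      (AffineSubspace.vsub_mem_direction (subset_affineSpan ℝ K hx) (subset_affineSpan ℝ K hz))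
    rw [inner_sub_right] at this
    linarith

/-- A vector maximised over a set at an interior point vanishes. -/
theorem eq_zero_of_forall_inner_le {n : ℕ} {K : Set (Euc n)} {z : Euc n} (hz : z ∈ interior K)
    {g : Euc n} (hg : ∀ x ∈ K, ⟪g, x⟫ ≤ ⟪g, z⟫) : g = 0 := by
  by_contra hg0
  obtain ⟨ε, hε, hsub⟩ := Metric.isOpen_iff.1 isOpen_interior z hz
  have hn : 0 < ‖g‖ := norm_pos_iff.2 hg0
  have hmem : z + (ε / (2 * ‖g‖)) • g ∈ ball z ε := by
    rw [mem_ball_iff_norm, add_sub_cancel_left, norm_smul, Real.norm_of_nonneg (by positivity)]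
    have : ε / (2 * ‖g‖) * ‖g‖ = ε / 2 := by field_simp
    linarith
  have := hg _ (interior_subset (hsub hmem))
  rw [inner_add_right, inner_smul_right, real_inner_self_eq_norm_sq] at this
  have : 0 < ε / (2 * ‖g‖) * ‖g‖ ^ 2 := by positivity
  linarith

theorem GenSol.convex_coin {n : ℕ} {q lam Lam : ℝ} {Ω : Set (Euc n)} {v : Euc n → ℝ}
    (hv : GenSol n q lam Lam Ω v) : Convex ℝ (coin Ω v) := by
  have : coin Ω v = {x ∈ Ω | v x ≤ 0} := by
    ext x
    exact ⟨fun h => ⟨h.1, h.2.le⟩, fun h => ⟨h.1, h.2.antisymm (hv.2.2.1 x h.1)⟩⟩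
  rw [this]
  exact hv.2.1.convex_le 0

theorem isCompact_coin_inter {n : ℕ} {q lam Lam : ℝ} {Ω : Set (Euc n)} {v : Euc n → ℝ}
    (hv : GenSol n q lam Lam Ω v) {S : Set (Euc n)} (hS : IsCompact S) (hSΩ : S ⊆ Ω) :
    IsCompact (coin Ω v ∩ S) := by
  have : coin Ω v ∩ S = S ∩ v ⁻¹' {0} := by
    ext x
    exact ⟨fun h => ⟨h.2, h.1.2⟩, fun h => ⟨⟨hSΩ h.1, h.2⟩, h.1⟩⟩
  rw [this]
  exact hS.of_isClosed_subset ((hv.1.mono hSΩ).preimage_isClosed_of_isClosed hS.isClosed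
    isClosed_singleton) inter_subset_left

theorem GenSol.mem_coin_of_mem_frontier {n : ℕ} {q lam Lam : ℝ} {Ω : Set (Euc n)} {v : Euc n → ℝ}
    (hv : GenSol n q lam Lam Ω v) {x : Euc n} (hx : x ∈ Ω) (hxf : x ∈ frontier (coin Ω v)) :
    x ∈ coin Ω v := by
  refine ⟨hx, le_antisymm ?_ (hv.2.2.1 x hx)⟩
  have h : ContinuousWithinAt v (coin Ω v) x := (hv.1 x hx).mono fun y hy => hy.1
  have := h.mem_closure_image (frontier_subset_closure hxf)
  have hsub : v '' coin Ω v ⊆ Iic 0 := by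
    rintro _ ⟨y, hy, rfl⟩
    exact hy.2.le
  exact closure_minimal hsub isClosed_Iic this

/-- No nondegenerate boundary segment of the coincidence set starts at an extreme point. -/
theorem not_segment_subset_frontier {n : ℕ} (hn : 0 < n) {q lam Lam : ℝ} (hq0 : 0 ≤ q)
    (hqn : q < n) (hlam : 0 < lam) (hLam : 0 < Lam) {Ω : Set (Euc n)} (hΩo : IsOpen Ω)
    {v : Euc n → ℝ} (hv : GenSol n q lam Lam Ω v) {x₀ y : Euc n}
    (hx₀ : x₀ ∈ Set.extremePoints ℝ (coin Ω v)) (hy : y ≠ x₀) :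
    ¬ segment ℝ x₀ y ⊆ Ω ∩ frontier (coin Ω v) := by
  intro hseg
  obtain ⟨N₀, hN₀⟩ := exists_forall_le hn hq0 hqn hlam hLam
  have hKc : Convex ℝ (coin Ω v) := hv.convex_coin
  have hsegK : segment ℝ x₀ y ⊆ coin Ω v := fun x hx =>
    hv.mem_coin_of_mem_frontier (hseg hx).1 (hseg hx).2
  have hx₀K : x₀ ∈ coin Ω v := hx₀.1
  have hyK : y ∈ coin Ω v := hsegK (right_mem_segment ℝ x₀ y)
  -- a supporting vector at the midpoint supports along the whole segment
  have hzseg := midpoint_mem_segment (𝕜 := ℝ) x₀ y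
  obtain ⟨g, hg0, hg⟩ := exists_supporting hKc (hsegK hzseg) (hseg hzseg).2.2
  have hmid : ⟪g, midpoint ℝ x₀ y⟫ = (⟪g, x₀⟫ + ⟪g, y⟫) / 2 := by
    rw [midpoint_eq_smul_add, inner_smul_right, inner_add_right]
    simp
    ring
  have hgy : ⟪g, y⟫ = ⟪g, x₀⟫ := by linarith [hg _ hx₀K, hg _ hyK]
  have hgx : ∀ x ∈ coin Ω v, ⟪g, x⟫ ≤ ⟪g, x₀⟫ := fun x hx => by linarith [hg _ hx]
  -- a small ball around the extreme point
  have hyn : 0 < ‖y - x₀‖ := norm_pos_iff.2 (sub_ne_zero.2 hy)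
  obtain ⟨r, hr0, hrΩ, hry⟩ : ∃ r > 0, closedBall x₀ r ⊆ Ω ∧ r < ‖y - x₀‖ := by
    obtain ⟨ε, hε, hsub⟩ := Metric.isOpen_iff.1 hΩo x₀ hx₀K.1
    refine ⟨min (ε / 2) (‖y - x₀‖ / 2), by positivity,
      (closedBall_subset_ball ?_).trans hsub, ?_⟩
    · linarith [min_le_left (ε / 2) (‖y - x₀‖ / 2)]
    · linarith [min_le_right (ε / 2) (‖y - x₀‖ / 2)]
  -- the face of the coincidence set
  set D : Set (Euc n) := coin Ω v ∩ closedBall x₀ r ∩ {x | ⟪g, x⟫ = ⟪g, x₀⟫} with hD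
  have hKr : IsCompact (coin Ω v ∩ closedBall x₀ r) :=
    isCompact_coin_inter hv (isCompact_closedBall _ _) hrΩ
  have hKs : IsCompact (coin Ω v ∩ sphere x₀ r) :=
    isCompact_coin_inter hv (isCompact_sphere _ _) (sphere_subset_closedBall.trans hrΩ)
  have hDcl : IsClosed {x : Euc n | ⟪g, x⟫ = ⟪g, x₀⟫} :=
    isClosed_eq (by fun_prop) continuous_const
  have hDk : IsCompact D := hKr.inter_right hDcl
  have hDc : Convex ℝ D := (hKc.inter (convex_closedBall _ _)).inter
    (convex_hyperplane (innerSL ℝ g).toLinearMap.isLinear _)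
  have hx₀D : x₀ ∈ D := ⟨⟨hx₀K, mem_closedBall_self hr0.le⟩, rfl⟩
  have hTk : IsCompact (D ∩ sphere x₀ r) := hDk.inter_right isClosed_sphere
  obtain ⟨C, hCk, hCc, hTC, hCD, hxC⟩ := exists_compact_convex_of_extremePoint hDk hDc hTk
    inter_subset_left
    (inter_extremePoints_subset_extremePoints_of_subset
      (fun x hx => hx.1.1 : D ⊆ coin Ω v) ⟨hx₀D, hx₀⟩)
    (fun h => hr0.ne (by simpa using h.2))
  obtain ⟨l, τ, hlC, hlx⟩ := geometric_hahn_banach_closed_point hCc hCk.isClosed hxC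
  set f₀ : Euc n := (InnerProductSpace.toDual ℝ (Euc n)).symm l with hf₀
  have hf₀l : ∀ x, ⟪f₀, x⟫ = l x := fun x => InnerProductSpace.toDual_symm_apply
  obtain ⟨x₁, hx₁D, hx₁max⟩ := hDk.exists_isMaxOn ⟨x₀, hx₀D⟩
    (f := fun x => ⟪f₀, x⟫) (by fun_prop)
  have hmax : ∀ x ∈ D, ⟪f₀, x⟫ ≤ ⟪f₀, x₁⟫ := fun x hx => hx₁max hx
  have hm : 0 < ⟪f₀, x₁⟫ - τ := by
    have := hmax x₀ hx₀D
    rw [hf₀l x₀] at this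
    linarith
  have hTτ : ∀ x ∈ D, x ∈ sphere x₀ r → ⟪f₀, x⟫ < τ := fun x hx hxs => by
    rw [hf₀l]
    exact hlC x (hTC ⟨hx, hxs⟩)
  have hx₁b : x₁ ∈ ball x₀ r := by
    rcases (mem_closedBall.1 hx₁D.1.2).lt_or_eq with h | h
    · exact h
    · linarith [hTτ x₁ hx₁D h]
  -- the scales
  set C₂ : ℝ := 2 * 2 ^ (n + 1) + 1 with hC₂
  have hC₂1 : 1 < C₂ := by rw [hC₂]; linarith [pow_pos (two_pos (α := ℝ)) (n + 1)]
  set s : ℝ := (⟪f₀, x₁⟫ - τ) / C₂ with hs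
  have hs0 : 0 < s := by positivity
  have hC₂s : C₂ * s = ⟪f₀, x₁⟫ - τ := by rw [hs]; field_simp
  obtain ⟨N, hN⟩ := exists_nat_gt (max N₀ 0)
  have hN1 : (0 : ℝ) < N := (le_max_right _ _).trans_lt hN
  have hψ0 : ∀ x ∈ coin Ω v, 0 ≤ -⟪g, x - x₁⟫ := fun x hx => by
    rw [inner_sub_right, hx₁D.2]
    linarith [hgx x hx]
  have hψD : ∀ x ∈ coin Ω v ∩ closedBall x₀ r, -⟪g, x - x₁⟫ = 0 → x ∈ D := fun x hx h => by
    rw [inner_sub_right, hx₁D.2] at h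
    exact ⟨hx, by simp only [mem_ofPred_eq]; linarith⟩
  obtain ⟨B₁, hB₁⟩ := exists_forall_sub_mul_neg hKr
    (φ := fun x => ⟪f₀, x - x₁⟫ - s / (4 * N)) (ψ := fun x => -⟪g, x - x₁⟫)
    (by fun_prop) (by fun_prop) (fun x hx => hψ0 x hx.1) (fun x hx h => by
      have h1 := hmax x (hψD x hx h)
      have h2 : 0 < s / (4 * N) := by positivity
      simp only [inner_sub_right]
      linarith)
  obtain ⟨B₂, hB₂⟩ := exists_forall_sub_mul_neg hKs
    (φ := fun x => ⟪f₀, x - x₁⟫ + C₂ * s) (ψ := fun x => -⟪g, x - x₁⟫)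
    (by fun_prop) (by fun_prop) (fun x hx => hψ0 x hx.1) (fun x hx h => by
      have h1 := hTτ x (hψD x ⟨hx.1, sphere_subset_closedBall hx.2⟩ h) hx.2
      simp only [inner_sub_right]
      linarith)
  set f : Euc n := f₀ + max B₁ B₂ • g with hf
  have hfi : ∀ x, ⟪f, x⟫ = ⟪f₀, x⟫ + max B₁ B₂ * ⟪g, x⟫ := fun x => by
    rw [hf, inner_add_left, real_inner_smul_left]
  obtain ⟨η₁, hη₁, hle₁⟩ := exists_pos_forall_le_imp_neg (isCompact_closedBall x₀ r)
    (φ := fun x => ⟪f, x - x₁⟫ - s / (4 * N)) (ψ := v) (by fun_prop) (hv.1.mono hrΩ)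
    (fun x hx => hv.2.2.1 x (hrΩ hx)) (fun x hx h => by
      have := hB₁ _ (le_max_left _ B₂) x ⟨⟨hrΩ hx, h⟩, hx⟩
      simp only [hfi] at this ⊢
      linarith)
  obtain ⟨η₂, hη₂, hle₂⟩ := exists_pos_forall_le_imp_neg (isCompact_sphere x₀ r)
    (φ := fun x => ⟪f, x - x₁⟫ + C₂ * s) (ψ := v) (by fun_prop)
    (hv.1.mono (sphere_subset_closedBall.trans hrΩ))
    (fun x hx => hv.2.2.1 x (hrΩ (sphere_subset_closedBall hx))) (fun x hx h => by
      have := hB₂ _ (le_max_right B₁ _) x ⟨⟨hrΩ (sphere_subset_closedBall hx), h⟩, hx⟩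
      simp only [hfi] at this ⊢
      linarith)
  -- the second point of the face
  set θ : ℝ := r / ‖y - x₀‖ with hθ
  have hθ0 : 0 < θ := by positivity
  have hθ1 : θ < 1 := (div_lt_one hyn).2 hry
  set y' : Euc n := x₀ + θ • (y - x₀) with hy'
  have hy'K : y' ∈ coin Ω v := hsegK <| by
    rw [segment_eq_image']
    exact ⟨θ, ⟨hθ0.le, hθ1.le⟩, rfl⟩
  have hy's : y' ∈ sphere x₀ r := by
    rw [mem_sphere_iff_norm, hy', add_sub_cancel_left, norm_smul, Real.norm_of_nonneg hθ0.le,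
      hθ]
    field_simp
  have hgy' : ⟪g, y' - x₁⟫ = 0 := by
    rw [inner_sub_right, hx₁D.2, hy', inner_add_right, inner_smul_right, inner_sub_right, hgy]
    ring
  have hfy' := hle₂ y' hy's (by rw [hy'K.2]; exact hη₂.le)
  set a : ℝ := -⟪f, y' - x₁⟫ with ha
  have hsC : s ≤ C₂ * s := le_mul_of_one_le_left hs0.le hC₂1.le
  have has : s < a := by linarith
  set t : ℝ := s / 2 / a with ht
  have hta : t * a = s / 2 := div_mul_cancel₀ _ (by linarith)
  have ht0 : 0 < t := by rw [ht]; exact div_pos (by linarith) (by linarith)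
  have ht1 : t < 1 := by rw [ht, div_lt_one (by linarith)]; linarith
  set x₂ : Euc n := x₁ + t • (y' - x₁) with hx₂
  have hx₂K : x₂ ∈ coin Ω v := hKc.add_smul_sub_mem hx₁D.1.1 hy'K ⟨ht0.le, ht1.le⟩
  have hx₂b : x₂ ∈ ball x₀ r := by
    have h1 : x₂ - x₀ = (1 - t) • (x₁ - x₀) + t • (y' - x₀) := by rw [hx₂]; module
    have h2 : ‖x₁ - x₀‖ < r := mem_ball_iff_norm.1 hx₁b
    have h3 : ‖y' - x₀‖ = r := mem_sphere_iff_norm.1 hy's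
    rw [mem_ball_iff_norm, h1]
    refine (norm_add_le _ _).trans_lt ?_
    rw [norm_smul, norm_smul, Real.norm_of_nonneg ht0.le, Real.norm_of_nonneg (by linarith), h3]
    nlinarith
  have hle := hN₀ hv hrΩ (f := f) (g := g) (s := s) (η := min η₁ η₂) (N := N) hx₁b hx₁D.1.1.2
    hx₂b hx₂K.2 hg0
    (fun x hx => by linarith [hψ0 x hx]) hs0 (lt_min hη₁ hη₂) (by exact_mod_cast hN1)
    (fun x hx hxv => by
      have := hle₁ x hx (hxv.trans (min_le_left _ _))
      linarith)
    (fun x hx hxv => by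
      have := hle₂ x hx (hxv.trans (min_le_right _ _))
      linarith)
    (by
      rw [hx₂, add_sub_cancel_left, inner_smul_right]
      have : ⟪f, y' - x₁⟫ = -a := by rw [ha]; ring
      rw [this]
      linarith)
    (by rw [hx₂, add_sub_cancel_left, inner_smul_right, hgy', mul_zero])
  exact ((le_max_left _ _).trans_lt hN).not_ge hle

/-- A coincidence set with empty interior and an extreme point is a singleton. -/
theorem coin_eq_singleton {n : ℕ} (hn : 0 < n) {q lam Lam : ℝ} (hq0 : 0 ≤ q)
    (hqn : q < n) (hlam : 0 < lam) (hLam : 0 < Lam) {Ω : Set (Euc n)} (hΩo : IsOpen Ω)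
    {v : Euc n → ℝ} (hv : GenSol n q lam Lam Ω v) {x₀ : Euc n}
    (hx₀ : x₀ ∈ Set.extremePoints ℝ (coin Ω v)) (hint : interior (coin Ω v) = ∅) :
    coin Ω v = {x₀} := by
  refine Subset.antisymm (fun y hy => ?_) (singleton_subset_iff.2 hx₀.1)
  by_contra hne
  refine not_segment_subset_frontier hn hq0 hqn hlam hLam hΩo hv hx₀ hne fun x hx => ?_
  have hxK := hv.convex_coin.segment_subset hx₀.1 hy hx
  exact ⟨hxK.1, subset_closure hxK, by simp [hint]⟩
/-- **Extreme points of the coincidence set are exposed** (Lemma 2.11): if `x₀ ∈ Ω` is an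
extreme point of `K`, then `x₀` is not an endpoint of a nondegenerate line segment contained
in `Ω ∩ ∂K`, hence it is an exposed point of `K`; and if moreover `|K| = 0`, then
`K = {x₀}`. -/
theorem extreme_points_are_exposed
    (n : ℕ) (hn : 2 ≤ n) (q lam Lam : ℝ)
    (hq0 : 0 ≤ q) (hqn : q < n) (hlam : 0 < lam) (hlL : lam ≤ Lam)
    (Ω : Set (EuclideanSpace ℝ (Fin n))) (hΩo : IsOpen Ω) (hΩc : Convex ℝ Ω)
    (v : EuclideanSpace ℝ (Fin n) → ℝ) (hv : GenSol n q lam Lam Ω v)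
    (x₀ : EuclideanSpace ℝ (Fin n)) (hx₀Ω : x₀ ∈ Ω)
    (hx₀ : x₀ ∈ Set.extremePoints ℝ (coin Ω v)) :
    (¬ ∃ y, y ≠ x₀ ∧ segment ℝ x₀ y ⊆ Ω ∩ frontier (coin Ω v)) ∧
    x₀ ∈ Set.exposedPoints ℝ (coin Ω v) ∧
    (volume (coin Ω v) = 0 → coin Ω v = {x₀}) := by
  have hn0 : 0 < n := by omega
  have hLam : 0 < Lam := hlam.trans_le hlL
  have hKc : Convex ℝ (coin Ω v) := hv.convex_coin
  have hfront : ∀ y, y ≠ x₀ → ¬ segment ℝ x₀ y ⊆ Ω ∩ frontier (coin Ω v) := fun y hy =>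
    not_segment_subset_frontier hn0 hq0 hqn hlam hLam hΩo hv hx₀ hy
  refine ⟨fun ⟨y, hy, hseg⟩ => hfront y hy hseg, ⟨hx₀.1, ?_⟩, fun h0 => ?_⟩
  · have hxi : x₀ ∉ interior (coin Ω v) := fun hxi => by
      have : Nontrivial (Euc n) := by
        have : Nonempty (Fin n) := ⟨⟨0, hn0⟩⟩
        infer_instance
      obtain ⟨ε, hε, hsub⟩ := Metric.isOpen_iff.1 isOpen_interior x₀ hxi
      obtain ⟨w, hw⟩ := NormedSpace.exists_lt_norm ℝ (Euc n) 0
      have hc : ‖(ε / (2 * ‖w‖)) • w‖ < ε := by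
        rw [norm_smul, Real.norm_of_nonneg (by positivity)]
        have : ε / (2 * ‖w‖) * ‖w‖ = ε / 2 := by field_simp
        linarith
      have h1 : x₀ + (ε / (2 * ‖w‖)) • w ∈ coin Ω v :=
        interior_subset (hsub (by rw [mem_ball_iff_norm, add_sub_cancel_left]; exact hc))
      have h2 : x₀ - (ε / (2 * ‖w‖)) • w ∈ coin Ω v :=
        interior_subset (hsub (by
          rw [mem_ball_iff_norm, sub_sub_cancel_left, norm_neg]; exact hc))
      have h3 : x₀ ∈ openSegment ℝ (x₀ + (ε / (2 * ‖w‖)) • w) (x₀ - (ε / (2 * ‖w‖)) • w) :=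
        ⟨1 / 2, 1 / 2, by norm_num, by norm_num, by norm_num, by module⟩
      have h4 := hx₀.2 h1 h2 h3
      rw [add_eq_left, smul_eq_zero] at h4
      rcases h4 with h4 | h4
      · have : 0 < ε / (2 * ‖w‖) := by positivity
        exact this.ne' h4
      · simp [h4] at hw
    obtain ⟨g, hg0, hg⟩ := exists_supporting hKc hx₀.1 hxi
    refine ⟨innerSL ℝ g, fun y hy => ⟨by simpa using hg y hy, fun hle => ?_⟩⟩
    have hle' : ⟪g, x₀⟫ ≤ ⟪g, y⟫ := by simpa using hle
    by_contra hne
    refine hfront y hne fun x hx => ?_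
    have hxK := hKc.segment_subset hx₀.1 hy hx
    refine ⟨hxK.1, subset_closure hxK, fun hxint => hg0 ?_⟩
    refine eq_zero_of_forall_inner_le hxint fun z hz => (hg z hz).trans ?_
    obtain ⟨a, b, ha, hb, hab, rfl⟩ := hx
    rw [inner_add_right, inner_smul_right, inner_smul_right]
    have : ⟪g, x₀⟫ = a * ⟪g, x₀⟫ + b * ⟪g, x₀⟫ := by rw [← add_mul, hab, one_mul]
    linarith [mul_le_mul_of_nonneg_left hle' hb]
  · exact coin_eq_singleton hn0 hq0 hqn hlam hLam hΩo hv hx₀ (volume.interior_eq_empty_of_null h0)
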